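/- arXiv:1309.0751 — 3 statements merged into one kernel-verified Lean document; each statement's English description precedes it below -/
import Mathlib

section
/- Fix integers r ≥ 1 and n with n ≥ 2r + 2 and n ≡ 1 (mod r), and integers A, B. Suppose the polynomial P = ∑_{i=0}^{(n−1)/r − 1} x_{ri+1}·x_{ri+r} + A·∑_{i=0}^{(n−1)/r − 2} x_{ri+r}·x_{ri+r+1} + B is irreducible in ℤ[x_1,…,x_{n−1}] and not divisible by any x_j. Then every term of any sequence x : ℕ → F generated by P is a Laurent polynomial. -/
section Hopping

variable {K : Type*} [Field K] {x : ℕ → K} {r k : ℕ} {A B : K}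

/-- The `r`-hopping recurrence of order `r * (k + 1) + 1`. -/
def IsHopping (r k : ℕ) (A B : K) (x : ℕ → K) : Prop :=
  ∀ m, x m * x (m + (r * (k + 1) + 1)) =
    (∑ i ∈ Finset.range (k + 1), x (m + (r * i + 1)) * x (m + (r * i + r))) +
      A * (∑ i ∈ Finset.range k, x (m + (r * i + r)) * x (m + (r * i + r + 1))) + B

/-- The four-term linear combination that is an invariant of the hopping recurrence
up to a product of consecutive terms. -/
def hoppingSum (r k : ℕ) (A : K) (x : ℕ → K) (m : ℕ) : K :=
  x m + A * x (m + r) + A * x (m + r * (k + 1)) + x (m + (r * (k + 1) + r))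

theorem IsHopping.mul_hoppingSum (h : IsHopping r k A B x) (m : ℕ) :
    x (m + (r * (k + 1) + 1)) * hoppingSum r k A x m =
      x (m + r) * hoppingSum r k A x (m + 1) := by
  have h₀ := h m
  have h₁ := h (m + r)
  set f : ℕ → K := fun i => x (m + (r * i + 1)) * x (m + (r * i + r)) with hf
  set g : ℕ → K := fun i => x (m + (r * i + r)) * x (m + (r * i + r + 1)) with hg
  have shift_f : ∑ i ∈ Finset.range (k + 1),
      x (m + r + (r * i + 1)) * x (m + r + (r * i + r)) =
      ∑ i ∈ Finset.range (k + 1), f (i + 1) :=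
    Finset.sum_congr rfl fun i _ => by simp only [hf]; congr 2 <;> ring
  have shift_g : ∑ i ∈ Finset.range k,
      x (m + r + (r * i + r)) * x (m + r + (r * i + r + 1)) =
      ∑ i ∈ Finset.range k, g (i + 1) :=
    Finset.sum_congr rfl fun i _ => by simp only [hg]; congr 2 <;> ring
  rw [shift_f, shift_g] at h₁
  have tf := (Finset.sum_range_succ f (k + 1)).symm.trans (Finset.sum_range_succ' f (k + 1))
  have tg := (Finset.sum_range_succ g k).symm.trans (Finset.sum_range_succ' g k)
  have f₀ : f 0 = x (m + 1) * x (m + r) := by simp [hf]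
  have g₀ : g 0 = x (m + r) * x (m + 1 + r) := by
    simp only [hg]; congr 2 <;> ring
  have f₁ : f (k + 1) = x (m + (r * (k + 1) + 1)) * x (m + (r * (k + 1) + r)) := rfl
  have g₁ : g k = x (m + r * (k + 1)) * x (m + (r * (k + 1) + 1)) := by
    simp only [hg]; congr 2
  have e₁ : m + 1 + r * (k + 1) = m + (r * (k + 1) + 1) := by ring
  have e₂ : m + 1 + (r * (k + 1) + r) = m + r + (r * (k + 1) + 1) := by ring
  rw [f₀, f₁] at tf
  rw [g₀, g₁] at tg
  simp only [hoppingSum, e₁, e₂]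
  linear_combination h₀ - h₁ + tf + A * tg

theorem IsHopping.hoppingSum_eq (h : IsHopping r k A B x) (hnz : ∀ m, x m ≠ 0) (m : ℕ) :
    hoppingSum r k A x m =
      hoppingSum r k A x 0 * (∏ j ∈ Finset.range (r * k + 1), x (r + j))⁻¹ *
        ∏ j ∈ Finset.range (r * k + 1), x (m + r + j) := by
  induction m with
  | zero =>
    have : ∏ j ∈ Finset.range (r * k + 1), x (r + j) ≠ 0 :=
      Finset.prod_ne_zero_iff.mpr fun j _ => hnz _
    simp [this]
  | succ m ih =>
    have key := h.mul_hoppingSum m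
    have hQ : (∏ j ∈ Finset.range (r * k + 1), x (m + 1 + r + j)) * x (m + r) =
        (∏ j ∈ Finset.range (r * k + 1), x (m + r + j)) * x (m + (r * (k + 1) + 1)) := by
      have t := (Finset.prod_range_succ (fun j => x (m + r + j)) (r * k + 1)).symm.trans
        (Finset.prod_range_succ' (fun j => x (m + r + j)) (r * k + 1))
      have e : m + (r * (k + 1) + 1) = m + r + (r * k + 1) := by ring
      rw [e, t]
      refine congrArg₂ _ (Finset.prod_congr rfl fun j _ => ?_) rfl
      congr 1; ring
    apply mul_left_cancel₀ (hnz (m + r))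
    rw [← key, ih]
    linear_combination (-(hoppingSum r k A x 0 *
      (∏ j ∈ Finset.range (r * k + 1), x (r + j))⁻¹)) * hQ

/-- All terms of a hopping sequence lie in any subring containing the coefficients,
the initial terms and the inverses of the initial terms. -/
theorem IsHopping.mem (h : IsHopping r k A B x) (hr : 1 ≤ r) (hnz : ∀ m, x m ≠ 0)
    (S : Subring K) (hA : A ∈ S) (hB : B ∈ S)
    (hx : ∀ i < r * (k + 1) + 1, x i ∈ S) (hinv : ∀ i < r * (k + 1) + 1, (x i)⁻¹ ∈ S)
    (m : ℕ) : x m ∈ S := by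
  have hsucc : r * (k + 1) = r * k + r := by ring
  have start : ∀ m ≤ r * (k + 1) + r, x m ∈ S := by
    intro m
    induction m using Nat.strong_induction_on with
    | _ m ih =>
      intro hm
      rcases lt_or_ge m (r * (k + 1) + 1) with hlt | hge
      · exact hx m hlt
      obtain ⟨j, rfl⟩ := Nat.exists_eq_add_of_le' hge
      have hidx : ∀ i ≤ k, r * i + r ≤ r * (k + 1) := fun i hi => by
        have := Nat.mul_le_mul_left r hi
        omega
      have hmem : ∀ i, i ≤ r * (k + 1) → x (j + i) ∈ S := fun i hi =>
        ih _ (by omega) (by omega)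
      rw [(eq_inv_mul_iff_mul_eq₀ (hnz j)).mpr (h j)]
      refine S.mul_mem (hinv j (by omega)) (S.add_mem (S.add_mem ?_ (S.mul_mem hA ?_)) hB)
      · refine S.sum_mem fun i hi => ?_
        have := hidx i (by have := Finset.mem_range.mp hi; omega)
        exact S.mul_mem (hmem _ (by omega)) (hmem _ (by omega))
      · refine S.sum_mem fun i hi => ?_
        have := hidx (i + 1) (by have := Finset.mem_range.mp hi; omega)
        rw [Nat.mul_succ] at this
        exact S.mul_mem (hmem _ (by omega)) (hmem _ (by omega))
  have hI : hoppingSum r k A x 0 * (∏ j ∈ Finset.range (r * k + 1), x (r + j))⁻¹ ∈ S := by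
    refine S.mul_mem ?_ ?_
    · exact S.add_mem (S.add_mem (S.add_mem (start _ (by omega))
        (S.mul_mem hA (start _ (by omega)))) (S.mul_mem hA (start _ (by omega))))
        (start _ (by omega))
    · rw [← Finset.prod_inv_distrib]
      refine S.prod_mem fun j hj => hinv _ ?_
      have := Finset.mem_range.mp hj
      omega
  induction m using Nat.strong_induction_on with
  | _ m ih =>
    rcases lt_or_ge m (r * (k + 1) + r) with hlt | hge
    · exact start m hlt.le
    obtain ⟨j, rfl⟩ := Nat.exists_eq_add_of_le' hge
    have key := h.hoppingSum_eq hnz j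
    have hprod : ∏ i ∈ Finset.range (r * k + 1), x (j + r + i) ∈ S :=
      S.prod_mem fun i hi => ih _ (by have := Finset.mem_range.mp hi; omega)
    have hrest : x j + A * x (j + r) + A * x (j + r * (k + 1)) ∈ S := by
      have : 0 < r * (k + 1) := by positivity
      exact S.add_mem (S.add_mem (ih _ (by omega)) (S.mul_mem hA (ih _ (by omega))))
        (S.mul_mem hA (ih _ (by omega)))
    rw [show x (j + (r * (k + 1) + r)) = hoppingSum r k A x j -
      (x j + A * x (j + r) + A * x (j + r * (k + 1))) by simp only [hoppingSum]; ring, key]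
    exact S.sub_mem (S.mul_mem hI hprod) hrest

end Hopping

open MvPolynomial

/-- r-Hopping polynomial case (family (8) of Theorem 3.7 with Corollary 3.8). -/
theorem stmt9 (n r : ℕ) (hr : 1 ≤ r) (hn : 2 * r + 2 ≤ n) (hmod : n % r = 1 % r)
    (A B : ℤ) (P : MvPolynomial ℕ ℤ)
    (hP : P = (∑ i ∈ Finset.range ((n - 1) / r), X (r * i + 1) * X (r * i + r)) +
        C A * (∑ i ∈ Finset.range ((n - 1) / r - 1), X (r * i + r) * X (r * i + r + 1)) + C B)
    (hirr : Irreducible P)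
    (hndvd : ∀ j ∈ Finset.Icc 1 (n - 1), ¬ X j ∣ P)
    (x : ℕ → FractionRing (MvPolynomial (Fin n) ℤ))
    (hinit : ∀ i : Fin n, x i =
      algebraMap (MvPolynomial (Fin n) ℤ) (FractionRing (MvPolynomial (Fin n) ℤ)) (X i))
    (hnz : ∀ m, x m ≠ 0)
    (hrec : ∀ m, x m * x (m + n) = aeval (fun i : ℕ => x (m + i)) P) :
    ∀ m, x m ∈ Subring.closure
      ((Set.range fun i : Fin n =>
          algebraMap (MvPolynomial (Fin n) ℤ) (FractionRing (MvPolynomial (Fin n) ℤ)) (X i)) ∪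
        (Set.range fun i : Fin n =>
          (algebraMap (MvPolynomial (Fin n) ℤ) (FractionRing (MvPolynomial (Fin n) ℤ)) (X i))⁻¹)) := by
  obtain ⟨k, rfl⟩ : ∃ k, n = r * (k + 1) + 1 := by
    have hd : r ∣ n - 1 := (Nat.modEq_iff_dvd' (by omega)).mp (Eq.symm hmod)
    obtain ⟨c, hc⟩ := hd
    obtain _ | c := c
    · omega
    · exact ⟨c, by omega⟩
  have hdiv : (r * (k + 1) + 1 - 1) / r = k + 1 := by
    rw [Nat.add_sub_cancel, Nat.mul_div_cancel_left _ hr]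
  have hop : IsHopping r k (A : FractionRing (MvPolynomial (Fin (r * (k + 1) + 1)) ℤ)) B x := by
    intro m
    rw [hrec m, hP, hdiv]
    simp [map_sum]
  refine hop.mem hr hnz _ (intCast_mem _ A) (intCast_mem _ B) (fun i hi => ?_) fun i hi => ?_
  · exact Subring.subset_closure (Or.inl ⟨⟨i, hi⟩, (hinit ⟨i, hi⟩).symm⟩)
  · exact Subring.subset_closure (Or.inr ⟨⟨i, hi⟩, congrArg _ (hinit ⟨i, hi⟩).symm⟩)
end

section
/- Fix n ≥ 2, disjoint subsets L, R ⊆ {1, …, n−1} satisfying (i ∈ L ⟺ n−i ∈ L) and (i ∈ R ⟺ n−i ∈ R), and a function a : L ∪ R → ℕ taking only positive values. Suppose the polynomial P = ∏_{i∈L} x_i^{a(i)} + ∏_{i∈R} x_i^{a(i)} is irreducible in ℤ[x_1,…,x_{n−1}] and not divisible by any x_j. Then every term of any sequence x : ℕ → F generated by P is a Laurent polynomial. -/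
open MvPolynomial

/-- The ring of integral Laurent polynomials in variables indexed by `σ`. -/
abbrev LaurentRing (σ : Type) : Type :=
  Localization (Submonoid.closure (Set.range (X : σ → MvPolynomial σ ℤ)))

namespace LaurentRing

variable {σ : Type}

lemma closure_le_nonZeroDivisors :
    Submonoid.closure (Set.range (X : σ → MvPolynomial σ ℤ)) ≤
      nonZeroDivisors (MvPolynomial σ ℤ) := by
  rw [Submonoid.closure_le]
  rintro _ ⟨i, rfl⟩
  exact mem_nonZeroDivisors_of_ne_zero (X_ne_zero i)

instance : IsDomain (LaurentRing σ) :=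
  IsLocalization.isDomain_localization closure_le_nonZeroDivisors

/-- The variables, as units of the Laurent polynomial ring. -/
noncomputable def U (j : σ) : (LaurentRing σ)ˣ :=
  (IsLocalization.map_units (LaurentRing σ)
    (⟨X j, Submonoid.subset_closure ⟨j, rfl⟩⟩ :
      Submonoid.closure (Set.range (X : σ → MvPolynomial σ ℤ)))).unit

lemma coe_U (j : σ) :
    (U j : LaurentRing σ) = algebraMap (MvPolynomial σ ℤ) (LaurentRing σ) (X j) := rfl

lemma exists_lift {T : Type} [CommRing T] (w : σ → Tˣ) :
    ∃ θ : LaurentRing σ →+* T, ∀ j : σ, θ (U j) = w j := by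
  have h : ∀ y : Submonoid.closure (Set.range (X : σ → MvPolynomial σ ℤ)),
      IsUnit ((eval₂Hom (Int.castRingHom T) fun j => (w j : T)) y) := by
    rintro ⟨y, hy⟩
    induction hy using Submonoid.closure_induction with
    | mem y hy =>
      obtain ⟨j, rfl⟩ := hy
      simp
    | one => simp
    | mul a b _ _ ha hb =>
      simp only [map_mul] at ha hb ⊢
      exact ha.mul hb
  refine ⟨IsLocalization.lift h, fun j => ?_⟩
  rw [coe_U, IsLocalization.lift_eq]
  simp

lemma subring_eq_top (C : Subring (LaurentRing σ)) (h : ∀ j : σ, (U j : LaurentRing σ) ∈ C)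
    (h' : ∀ j : σ, ((U j)⁻¹ : (LaurentRing σ)ˣ).1 ∈ C) : C = ⊤ := by
  rw [eq_top_iff]
  rintro z -
  have hpoly : ∀ f : MvPolynomial σ ℤ, algebraMap _ (LaurentRing σ) f ∈ C := by
    intro f
    induction f using MvPolynomial.induction_on with
    | C c =>
      rw [show (MvPolynomial.C c : MvPolynomial σ ℤ) = (c : MvPolynomial σ ℤ) by simp, map_intCast]
      exact intCast_mem C c
    | add p q hp hq => rw [map_add]; exact add_mem hp hq
    | mul_X p i hp => rw [map_mul]; exact mul_mem hp (h i)
  have hinv : ∀ s ∈ Submonoid.closure (Set.range (X : σ → MvPolynomial σ ℤ)),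
      ∃ c ∈ C, algebraMap _ (LaurentRing σ) s * c = 1 := by
    intro s hs
    induction hs using Submonoid.closure_induction with
    | mem y hy =>
      obtain ⟨j, rfl⟩ := hy
      exact ⟨_, h' j, (U j).mul_inv⟩
    | one => exact ⟨1, one_mem C, by simp⟩
    | mul a b _ _ ha hb =>
      obtain ⟨c, hc, hac⟩ := ha
      obtain ⟨d, hd, hbd⟩ := hb
      refine ⟨c * d, mul_mem hc hd, ?_⟩
      rw [map_mul, mul_mul_mul_comm, hac, hbd, one_mul]
  obtain ⟨⟨f, s⟩, hfs⟩ := IsLocalization.surj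
    (Submonoid.closure (Set.range (X : σ → MvPolynomial σ ℤ))) z
  obtain ⟨c, hc, hsc⟩ := hinv s s.2
  have : z = algebraMap _ (LaurentRing σ) f * c := by
    rw [← hfs, mul_assoc, hsc, mul_one]
  rw [this]
  exact mul_mem (hpoly f) hc

lemma map_U_inv {K : Type} [Field K] (θ : LaurentRing σ →+* K) (j : σ) :
    θ ((U j)⁻¹ : (LaurentRing σ)ˣ).1 = (θ (U j))⁻¹ := by
  apply eq_inv_of_mul_eq_one_left
  rw [← map_mul, Units.inv_mul, map_one]

lemma range_le {K : Type} [Field K] (θ : LaurentRing σ →+* K) (B : Subring K)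
    (h : ∀ j : σ, θ (U j) ∈ B) (h' : ∀ j : σ, (θ (U j))⁻¹ ∈ B) (z : LaurentRing σ) : θ z ∈ B := by
  have : B.comap θ = ⊤ := subring_eq_top _ h fun j => by
    rw [Subring.mem_comap, map_U_inv]
    exact h' j
  have hz : z ∈ B.comap θ := this ▸ Subring.mem_top z
  exact hz

lemma hom_ext {T : Type} [CommRing T] {f g : LaurentRing σ →+* T}
    (h : ∀ j : σ, f (U j) = g (U j)) : f = g := by
  have : f.eqLocus g = ⊤ := subring_eq_top _ h fun j => by
    change f _ = g _
    have : Units.map (f : LaurentRing σ →* T) (U j) = Units.map (g : LaurentRing σ →* T) (U j) :=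
      Units.ext (h j)
    simpa using congrArg (fun u : Tˣ => (u⁻¹).1) this
  ext1 z
  exact (this ▸ Subring.mem_top z : z ∈ f.eqLocus g)

/-- A variable minus a unit not involving that variable is prime. -/
lemma prime_U_sub {j₀ : σ} {b : LaurentRing σ} (hb : (U j₀ : LaurentRing σ) - b ≠ 0)
    (φ : LaurentRing σ →+* LaurentRing σ) (hφ : ∀ j : σ, j ≠ j₀ → φ (U j) = U j)
    (hφ₀ : φ (U j₀) = b) (hφb : φ b = b) : Prime ((U j₀ : LaurentRing σ) - b) := by
  have key : ∀ f, φ f = 0 → (U j₀ : LaurentRing σ) - b ∣ f := by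
    intro f hf
    have hcomp : (Ideal.Quotient.mk (Ideal.span {(U j₀ : LaurentRing σ) - b})).comp φ =
        Ideal.Quotient.mk (Ideal.span {(U j₀ : LaurentRing σ) - b}) := by
      refine hom_ext fun j => ?_
      rw [RingHom.comp_apply]
      rcases eq_or_ne j j₀ with rfl | hj
      · rw [hφ₀, eq_comm, Ideal.Quotient.eq]
        exact Ideal.mem_span_singleton_self _
      · rw [hφ j hj]
    rw [← Ideal.mem_span_singleton, ← Ideal.Quotient.eq_zero_iff_mem, ← hcomp, RingHom.comp_apply,
      hf, map_zero]
  have hz : φ ((U j₀ : LaurentRing σ) - b) = 0 := by rw [map_sub, hφ₀, hφb, sub_self]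
  refine ⟨hb, fun hu => (hu.map φ).ne_zero hz, fun f g hfg => ?_⟩
  have : φ f * φ g = 0 := by
    rw [← map_mul]
    obtain ⟨c, hc⟩ := hfg
    rw [hc, map_mul, hz, zero_mul]
  exact (mul_eq_zero.mp this).imp (key f) (key g)

end LaurentRing

/-- The elements of `K` which become elements of `S` after multiplication by an element of `M`. -/
def denomSubring {S K : Type} [CommRing S] [CommRing K] [Algebra S K] (M : Submonoid S) :
    Subring K where
  carrier := {z | ∃ s ∈ M, ∃ t, algebraMap S K s * z = algebraMap S K t}
  mul_mem' := by
    rintro a b ⟨s, hs, t, h⟩ ⟨s', hs', t', h'⟩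
    exact ⟨s * s', mul_mem hs hs', t * t', by rw [map_mul, map_mul, mul_mul_mul_comm, h, h']⟩
  one_mem' := ⟨1, one_mem M, 1, by simp⟩
  add_mem' := by
    rintro a b ⟨s, hs, t, h⟩ ⟨s', hs', t', h'⟩
    refine ⟨s * s', mul_mem hs hs', s' * t + s * t', ?_⟩
    simp only [map_mul, map_add, ← h, ← h']
    ring
  zero_mem' := ⟨1, one_mem M, 0, by simp⟩
  neg_mem' := by
    rintro a ⟨s, hs, t, h⟩
    exact ⟨s, hs, -t, by rw [mul_neg, h, map_neg]⟩

lemma algebraMap_mem_denomSubring {S K : Type} [CommRing S] [CommRing K] [Algebra S K]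
    (M : Submonoid S) (t : S) : algebraMap S K t ∈ denomSubring (K := K) M :=
  ⟨1, one_mem M, t, by simp⟩

lemma inv_algebraMap_mem_denomSubring {S K : Type} [CommRing S] [Field K] [Algebra S K]
    {M : Submonoid S} {t : S} (ht : t ∈ M) (h : algebraMap S K t ≠ 0) :
    (algebraMap S K t)⁻¹ ∈ denomSubring (K := K) M :=
  ⟨t, ht, 1, by rw [mul_inv_cancel₀ h, map_one]⟩

lemma inv_algebraMap_unit_mem_denomSubring {S K : Type} [CommRing S] [Field K] [Algebra S K]
    (M : Submonoid S) {t : S} (ht : IsUnit t) :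
    (algebraMap S K t)⁻¹ ∈ denomSubring (K := K) M := by
  obtain ⟨u, rfl⟩ := ht
  refine ⟨1, one_mem M, (u⁻¹ : Sˣ).1, ?_⟩
  rw [map_one, one_mul]
  apply inv_eq_of_mul_eq_one_right
  rw [← map_mul, Units.mul_inv, map_one]

lemma mem_range_of_mem_denomSubring {S K : Type} [CommRing S] [IsDomain S] [CommRing K]
    [Algebra S K] [FaithfulSMul S K] [IsDomain K]
    {M : Submonoid S} {y : S} (hy : Prime y) (hM : ∀ s ∈ M, ¬ y ∣ s) {z : K}
    (h : z ∈ denomSubring (K := K) (Submonoid.powers y)) (h' : z ∈ denomSubring (K := K) M) :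
    ∃ t, algebraMap S K t = z := by
  obtain ⟨_, ⟨e, rfl⟩, t, ht⟩ := h
  obtain ⟨s, hs, t', ht'⟩ := h'
  have inj := FaithfulSMul.algebraMap_injective S K
  have hst : s * t = y ^ e * t' := by
    apply inj
    simp only [map_mul, ← ht, ← ht']
    ring
  obtain ⟨c, rfl⟩ := hy.pow_dvd_of_dvd_mul_left e (hM s hs) ⟨t', hst⟩
  refine ⟨c, ?_⟩
  rw [map_mul] at ht
  refine (mul_left_cancel₀ ?_ ht).symm
  rw [Ne, map_eq_zero_iff _ inj]
  exact pow_ne_zero e hy.ne_zero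

lemma exists_recurrence {α : Type} {n : ℕ} (u : ℕ → α) (f : ℕ → (ℕ → α) → α)
    (hf : ∀ m v w, (∀ i < n, v (m + i) = w (m + i)) → f m v = f m w) :
    ∃ x : ℕ → α, (∀ i < n, x i = u i) ∧ ∀ m, x (m + n) = f m x := by
  let F : (m : ℕ) → ((k : ℕ) → k < m → α) → α := fun m rec =>
    if n ≤ m then f (m - n) (fun k => if h : k < m then rec k h else u k) else u m
  have hF : ∀ m, Nat.strongRec F m = F m fun k _ => Nat.strongRec F k := fun m => by
    rw [Nat.strongRec_eq]
  refine ⟨fun m => Nat.strongRec F m, fun i hi => ?_, fun m => ?_⟩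
  · exact (hF i).trans (if_neg (by omega))
  · refine (hF (m + n)).trans ((if_pos (by omega)).trans ?_)
    rw [Nat.add_sub_cancel]
    exact hf _ _ _ fun i hi => dif_pos (by omega)

/-- The combinatorial data of a flip-symmetric binomial. -/
structure FlipSymmetric (n : ℕ) (L R : Finset ℕ) (a : ℕ → ℕ) : Prop where
  pos : 0 < n
  memL : ∀ i ∈ L, 0 < i ∧ i < n
  memR : ∀ i ∈ R, 0 < i ∧ i < n
  disj : Disjoint L R
  symL : ∀ i ∈ L, n - i ∈ L
  symR : ∀ i ∈ R, n - i ∈ R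
  exp_pos : ∀ i ∈ L ∪ R, a i ≠ 0

/-- The binomial with coefficient `p m` on its first monomial, evaluated in the window of `x`
starting at `m`. -/
def binom {T : Type} [CommSemiring T] (L R : Finset ℕ) (a : ℕ → ℕ) (p x : ℕ → T) (m : ℕ) : T :=
  p m * ∏ i ∈ L, x (m + i) ^ a i + ∏ i ∈ R, x (m + i) ^ a i

lemma map_binom {S T : Type} [CommSemiring S] [CommSemiring T] (L R : Finset ℕ) (a : ℕ → ℕ)
    (θ : S →+* T) (p x : ℕ → S) (m : ℕ) :
    θ (binom L R a p x m) = binom L R a (fun i => θ (p i)) (fun i => θ (x i)) m := by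
  simp [binom]

/-- The recurrence for the coefficients which makes them compatible with the exchange relations. -/
def IsCoeffSeq {T : Type} [CommMonoid T] (n : ℕ) (R : Finset ℕ) (a : ℕ → ℕ) (p : ℕ → T) : Prop :=
  ∀ m, p m * p (m + n) = ∏ i ∈ R, p (m + i) ^ a i

namespace FlipSymmetric

variable {n : ℕ} {L R : Finset ℕ} {a : ℕ → ℕ}

lemma binom_congr (h : FlipSymmetric n L R a) {T : Type} [CommSemiring T] {p q x y : ℕ → T} {m : ℕ}
    (hp : p m = q m) (hx : ∀ i, 0 < i → i < n → x (m + i) = y (m + i)) :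
    binom L R a p x m = binom L R a q y m := by
  unfold binom
  rw [hp, Finset.prod_congr rfl fun i hi => by rw [hx i (h.memL i hi).1 (h.memL i hi).2],
    Finset.prod_congr (s₁ := R) rfl fun i hi => by rw [hx i (h.memR i hi).1 (h.memR i hi).2]]

/-- Singularity confinement: if `x n` vanishes, so does the numerator of `x (2 * n)`. -/
lemma binom_eq_zero (h : FlipSymmetric n L R a) {T : Type} [CommRing T] {p x : ℕ → T}
    (hx : ∀ m < n, x m * x (m + n) = binom L R a p x m) (hunit : ∀ i < n, IsUnit (x i))
    (hp : p 0 * p n = ∏ i ∈ R, p i ^ a i) (hp0 : IsUnit (p 0)) (h0 : x n = 0) :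
    binom L R a p x n = 0 := by
  have hLk : ∀ k ∈ L, x k * x (n + k) = ∏ i ∈ R, x (k + i) ^ a i := by
    intro k hk
    have hkn := h.memL k hk
    rw [add_comm n k, hx k hkn.2, binom, Finset.prod_eq_zero (h.symL k hk), mul_zero, zero_add]
    rw [Nat.add_sub_cancel' hkn.2.le, h0,
      zero_pow (h.exp_pos _ (Finset.mem_union_left _ (h.symL k hk)))]
  have hRk : ∀ k ∈ R, x k * x (n + k) = p k * ∏ i ∈ L, x (k + i) ^ a i := by
    intro k hk
    have hkn := h.memR k hk
    rw [add_comm n k, hx k hkn.2, binom, Finset.prod_eq_zero (s := R) (h.symR k hk), add_zero]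
    rw [Nat.add_sub_cancel' hkn.2.le, h0,
      zero_pow (h.exp_pos _ (Finset.mem_union_right _ (h.symR k hk)))]
  have hA : (∏ k ∈ L, x k ^ a k) * ∏ k ∈ L, x (n + k) ^ a k =
      ∏ k ∈ L, ∏ i ∈ R, x (k + i) ^ (a i * a k) := by
    rw [← Finset.prod_mul_distrib]
    refine Finset.prod_congr rfl fun k hk => ?_
    rw [← mul_pow, hLk k hk, ← Finset.prod_pow]
    simp only [pow_mul]
  have hB : (∏ k ∈ R, x k ^ a k) * ∏ k ∈ R, x (n + k) ^ a k =
      p 0 * p n * ∏ k ∈ L, ∏ i ∈ R, x (k + i) ^ (a i * a k) := by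
    rw [← Finset.prod_mul_distrib, hp, Finset.prod_comm, ← Finset.prod_mul_distrib]
    refine Finset.prod_congr rfl fun k hk => ?_
    rw [← mul_pow, hRk k hk, mul_pow, ← Finset.prod_pow]
    simp only [← pow_mul, add_comm k, mul_comm (a k)]
  have h00 : p 0 * ∏ i ∈ L, x i ^ a i + ∏ i ∈ R, x i ^ a i = 0 := by
    have := hx 0 h.pos
    rw [zero_add, h0, mul_zero, binom] at this
    simpa using this.symm
  have hu : IsUnit (p 0 * ∏ i ∈ L, x i ^ a i) :=
    hp0.mul (IsUnit.prod_iff.mpr fun i hi => (hunit i (h.memL i hi).2).pow _)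
  rw [← hu.mul_right_eq_zero, binom]
  linear_combination (p 0 * p n) * hA - hB + (∏ i ∈ R, x (n + i) ^ a i) * h00

lemma dvd_binom (h : FlipSymmetric n L R a) {S : Type} [CommRing S] {p x : ℕ → S}
    (hx : ∀ m < n, x m * x (m + n) = binom L R a p x m) (hunit : ∀ i < n, IsUnit (x i))
    (hp : p 0 * p n = ∏ i ∈ R, p i ^ a i) (hp0 : IsUnit (p 0)) :
    x n ∣ binom L R a p x n := by
  rw [← Ideal.mem_span_singleton, ← Ideal.Quotient.eq_zero_iff_mem, map_binom]
  refine h.binom_eq_zero (fun m hm => ?_) (fun i hi => (hunit i hi).map _) ?_ (hp0.map _) ?_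
  · rw [← map_binom, ← hx m hm, map_mul]
  · rw [← map_mul, hp, map_prod]
    simp only [map_pow]
  · rw [Ideal.Quotient.eq_zero_iff_mem]
    exact Ideal.mem_span_singleton_self _

lemma map_coeff_eq (h : FlipSymmetric n L R a) {S T : Type} [CommRing S] [CommRing T] [IsDomain T]
    (θ : S →+* T) {p : ℕ → S} {q : ℕ → T} (hp : IsCoeffSeq n R a p) (hq : IsCoeffSeq n R a q)
    (hq0 : ∀ m, q m ≠ 0) (hinit : ∀ i < n, θ (p i) = q i) (m : ℕ) : θ (p m) = q m := by
  induction m using Nat.strong_induction_on with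
  | _ m ih =>
    rcases lt_or_ge m n with hm | hm
    · exact hinit m hm
    · obtain ⟨k, rfl⟩ := Nat.exists_eq_add_of_le' hm
      have hk : k < k + n := by have := h.pos; omega
      apply mul_left_cancel₀ (hq0 k)
      rw [hq k, ← ih k hk, ← map_mul, hp k, map_prod]
      refine Finset.prod_congr rfl fun i hi => ?_
      rw [map_pow, ih _ (by have := (h.memR i hi).2; omega)]

lemma map_eq (h : FlipSymmetric n L R a) {S T : Type} [CommRing S] [CommRing T] [IsDomain T]
    (θ : S →+* T) {p x : ℕ → S} {q y : ℕ → T} {N : ℕ}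
    (hx : ∀ m, m + n ≤ N → x m * x (m + n) = binom L R a p x m)
    (hy : ∀ m, y m * y (m + n) = binom L R a q y m) (hy0 : ∀ m, y m ≠ 0)
    (hpq : ∀ m, θ (p m) = q m) (hinit : ∀ i < n, θ (x i) = y i) (m : ℕ) (hm : m ≤ N) :
    θ (x m) = y m := by
  induction m using Nat.strong_induction_on with
  | _ m ih =>
    rcases lt_or_ge m n with hmn | hmn
    · exact hinit m hmn
    · obtain ⟨k, rfl⟩ := Nat.exists_eq_add_of_le' hmn
      have hk : k < k + n := by have := h.pos; omega
      apply mul_left_cancel₀ (hy0 k)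
      rw [hy k, ← ih k hk (by omega), ← map_mul, hx k hm, map_binom]
      exact h.binom_congr (hpq k) fun i _ hi => ih _ (by omega) (by omega)

end FlipSymmetric

/-- The quotients of elements at which `ev` is positive. -/
def positiveQuotients {S K : Type} [CommRing S] [CommRing K] [Algebra S K] (ev : S →+* ℤ) :
    Submonoid K where
  carrier := {z | ∃ s t, 0 < ev s ∧ 0 < ev t ∧ algebraMap S K t * z = algebraMap S K s}
  mul_mem' := by
    rintro x y ⟨s, t, hs, ht, hx⟩ ⟨s', t', hs', ht', hy⟩
    refine ⟨s * s', t * t', ?_, ?_, ?_⟩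
    · rw [map_mul]; exact mul_pos hs hs'
    · rw [map_mul]; exact mul_pos ht ht'
    · rw [map_mul, map_mul, mul_mul_mul_comm, hx, hy]
  one_mem' := ⟨1, 1, by simp, by simp, by simp⟩

section positiveQuotients

variable {S K : Type} [CommRing S] [Field K] [Algebra S K] {ev : S →+* ℤ}

lemma algebraMap_mem_positiveQuotients {s : S} (hs : 0 < ev s) :
    algebraMap S K s ∈ positiveQuotients (K := K) ev :=
  ⟨s, 1, hs, by simp, by simp⟩

lemma add_mem_positiveQuotients {x y : K} (hx : x ∈ positiveQuotients (K := K) ev)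
    (hy : y ∈ positiveQuotients (K := K) ev) : x + y ∈ positiveQuotients (K := K) ev := by
  obtain ⟨s, t, hs, ht, hx⟩ := hx
  obtain ⟨s', t', hs', ht', hy⟩ := hy
  refine ⟨t' * s + t * s', t * t', ?_, ?_, ?_⟩
  · rw [map_add, map_mul, map_mul]; positivity
  · rw [map_mul]; positivity
  · simp only [map_mul, map_add, ← hx, ← hy]; ring

variable [FaithfulSMul S K]

lemma algebraMap_ne_zero_of_pos {s : S} (hs : 0 < ev s) : algebraMap S K s ≠ 0 := by
  rw [Ne, map_eq_zero_iff _ (FaithfulSMul.algebraMap_injective S K)]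
  rintro rfl
  simp at hs

lemma ne_zero_of_mem_positiveQuotients {x : K} (hx : x ∈ positiveQuotients (K := K) ev) :
    x ≠ 0 := by
  obtain ⟨s, t, hs, ht, hx⟩ := hx
  rintro rfl
  rw [mul_zero] at hx
  exact algebraMap_ne_zero_of_pos hs hx.symm

lemma inv_mem_positiveQuotients {x : K} (hx : x ∈ positiveQuotients (K := K) ev) :
    x⁻¹ ∈ positiveQuotients (K := K) ev := by
  have h0 := ne_zero_of_mem_positiveQuotients hx
  obtain ⟨s, t, hs, ht, hx⟩ := hx
  exact ⟨t, s, ht, hs, by rw [← hx, mul_assoc, mul_inv_cancel₀ h0, mul_one]⟩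

end positiveQuotients

namespace FlipSymmetric

variable {n : ℕ} {L R : Finset ℕ} {a : ℕ → ℕ}

lemma exists_coeffSeq (h : FlipSymmetric n L R a) {G : Type} [CommGroup G] (u : ℕ → G) :
    ∃ p : ℕ → G, (∀ i < n, p i = u i) ∧ IsCoeffSeq n R a p := by
  obtain ⟨p, hp, hrec⟩ := exists_recurrence u
    (fun m v => (v m)⁻¹ * ∏ i ∈ R, v (m + i) ^ a i) fun m v w hvw => by
      rw [show v m = w m from hvw 0 h.pos,
        Finset.prod_congr rfl fun i hi => by rw [hvw i (h.memR i hi).2]]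
  exact ⟨p, hp, fun m => by rw [hrec, mul_inv_cancel_left]⟩

/-- In the fraction field of a ring with a positive point, positive initial values extend to a
nowhere vanishing solution of the exchange relations. -/
lemma exists_clusterSeq (h : FlipSymmetric n L R a) {S K : Type} [CommRing S] [Field K]
    [Algebra S K] [FaithfulSMul S K] (ev : S →+* ℤ) {p u : ℕ → S} (hp : ∀ m, 0 < ev (p m))
    (hu : ∀ m, 0 < ev (u m)) :
    ∃ x : ℕ → K, (∀ i < n, x i = algebraMap S K (u i)) ∧ (∀ m, x m ≠ 0) ∧
      ∀ m, x m * x (m + n) = binom L R a (fun i => algebraMap S K (p i)) x m := by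
  obtain ⟨x, hx, hrec⟩ := exists_recurrence (fun i => algebraMap S K (u i))
    (fun m v => (v m)⁻¹ * binom L R a (fun i => algebraMap S K (p i)) v m) fun m v w hvw => by
      rw [show v m = w m from hvw 0 h.pos, h.binom_congr rfl fun i _ hi => hvw i hi]
  have hpos : ∀ m, x m ∈ positiveQuotients (K := K) ev := by
    intro m
    induction m using Nat.strong_induction_on with
    | _ m ih =>
      rcases lt_or_ge m n with hm | hm
      · rw [hx m hm]
        exact algebraMap_mem_positiveQuotients (hu m)
      · obtain ⟨k, rfl⟩ := Nat.exists_eq_add_of_le' hm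
        rw [hrec]
        have := h.pos
        refine mul_mem (inv_mem_positiveQuotients (ih k (by omega))) (add_mem_positiveQuotients
          (mul_mem (algebraMap_mem_positiveQuotients (hp k)) ?_) ?_)
        · refine prod_mem fun i hi => pow_mem (ih _ ?_) _
          have := (h.memL i hi).2
          omega
        · refine prod_mem fun i hi => pow_mem (ih _ ?_) _
          have := (h.memR i hi).2
          omega
  have hx0 := fun m => ne_zero_of_mem_positiveQuotients (hpos m)
  exact ⟨x, hx, hx0, fun m => by rw [hrec, mul_inv_cancel_left₀ (hx0 m)]⟩

end FlipSymmetric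

namespace FlipSymmetric

variable {n : ℕ} {L R : Finset ℕ} {a : ℕ → ℕ}

lemma pos_of_confined (h : FlipSymmetric n L R a) {p c : ℕ → ℤ}
    (hc : ∀ i, 0 < i → i < n → c i = 1) (hcn : c n = 0) (hp : ∀ i, 0 < i → i < n → p i = 1)
    (hrec : ∀ m, 0 < m → m < n → c m * c (m + n) = binom L R a p c m) (j : ℕ) (hj : 0 < j)
    (hjn : j < n) : 0 < c (j + n) := by
  induction j using Nat.strong_induction_on with
  | _ j ih =>
    have hpos : ∀ i, 0 < i → i < n → i ≠ n - j → 0 < c (j + i) := by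
      intro i hi hin hne
      rcases lt_or_ge (j + i) n with hlt | hge
      · rw [hc _ (by omega) hlt]
        exact one_pos
      · have := ih (j + i - n) (by omega) (by omega) (by omega)
        rwa [Nat.sub_add_cancel hge] at this
    have hnonneg : ∀ i, 0 < i → i < n → 0 ≤ c (j + i) := by
      intro i hi hin
      by_cases hne : i = n - j
      · rw [hne, Nat.add_sub_cancel' hjn.le, hcn]
      · exact (hpos i hi hin hne).le
    have hrecj := hrec j hj hjn
    rw [hc j hj hjn, one_mul, binom, hp j hj hjn, one_mul] at hrecj
    rw [hrecj]
    by_cases hL : n - j ∈ L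
    · refine add_pos_of_nonneg_of_pos (Finset.prod_nonneg fun i hi =>
        pow_nonneg (hnonneg i (h.memL i hi).1 (h.memL i hi).2) _) (Finset.prod_pos fun i hi =>
        pow_pos (hpos i (h.memR i hi).1 (h.memR i hi).2 ?_) _)
      rintro rfl
      exact Finset.disjoint_left.mp h.disj hL hi
    · refine add_pos_of_pos_of_nonneg (Finset.prod_pos fun i hi =>
        pow_pos (hpos i (h.memL i hi).1 (h.memL i hi).2 ?_) _) (Finset.prod_nonneg fun i hi =>
        pow_nonneg (hnonneg i (h.memR i hi).1 (h.memR i hi).2) _)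
      rintro rfl
      exact hL hi

open DualNumber in
lemma fst_dual (L R : Finset ℕ) (a : ℕ → ℕ) {s : ℤ} {p x : ℕ → DualNumber ℤ} (hxn : x n = ε)
    (hrec : x n * x (n + n) = binom L R a p x n)
    (hpn : p n * (-1 + (s : DualNumber ℤ) * ε) = 1) :
    -(x (n + n)).fst = (∏ i ∈ L, x (n + i) ^ a i).snd - (∏ i ∈ R, x (n + i) ^ a i).snd +
      s * (∏ i ∈ R, x (n + i) ^ a i).fst := by
  rw [hxn, binom] at hrec
  have key : (-1 + (s : DualNumber ℤ) * ε) * (ε * x (n + n)) =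
      (∏ i ∈ L, x (n + i) ^ a i) +
        (-1 + (s : DualNumber ℤ) * ε) * (∏ i ∈ R, x (n + i) ^ a i) := by
    rw [hrec]
    linear_combination (∏ i ∈ L, x (n + i) ^ a i) * hpn
  have := congrArg TrivSqZeroExt.snd key
  simp at this
  linarith

/-- There is an integral point at which `x n` vanishes but the next `n` terms do not. -/
lemma exists_point (h : FlipSymmetric n L R a) {p x : ℕ → LaurentRing (ℕ ⊕ ℕ)}
    (hp : ∀ i < n, p i = LaurentRing.U (Sum.inr i : ℕ ⊕ ℕ))
    (hx : ∀ i < n, x i = LaurentRing.U (Sum.inl i : ℕ ⊕ ℕ))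
    (hpn : p 0 * p n = ∏ i ∈ R, p i ^ a i)
    (hrec : ∀ m ≤ n, x m * x (m + n) = binom L R a p x m) :
    ∃ ψ : LaurentRing (ℕ ⊕ ℕ) →+* ℤ, ψ (x n) = 0 ∧ ∀ j, 0 < j → j ≤ n → ψ (x (j + n)) ≠ 0 := by
  have hex : ∀ s : ℤˣ, ∃ ψ : LaurentRing (ℕ ⊕ ℕ) →+* DualNumber ℤ,
      ψ (p 0) = -1 + ((s : ℤ) : DualNumber ℤ) * DualNumber.eps ∧
      ψ (x 0) = ((s : ℤ) : DualNumber ℤ) ∧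
      (∀ i, 0 < i → i < n → ψ (p i) = 1) ∧ ∀ i, 0 < i → i < n → ψ (x i) = 1 := by
    intro s
    have hu : (-1 + ((s : ℤ) : DualNumber ℤ) * DualNumber.eps) *
        (-1 - ((s : ℤ) : DualNumber ℤ) * DualNumber.eps) = 1 := by
      linear_combination -((s : ℤ) : DualNumber ℤ) ^ 2 * DualNumber.eps_mul_eps (R := ℤ)
    obtain ⟨ψ, hψ⟩ := LaurentRing.exists_lift (T := DualNumber ℤ) (Sum.elim
      (fun i : ℕ => if i = 0 then Units.map (Int.castRingHom (DualNumber ℤ)).toMonoidHom s else 1)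
      (fun i : ℕ => if i = 0 then Units.mkOfMulEqOne _ _ hu else 1))
    refine ⟨ψ, ?_, ?_, fun i hi hin => ?_, fun i hi hin => ?_⟩
    · simp [hp 0 h.pos, hψ]
    · simp [hx 0 h.pos, hψ]
    · simp [hp i hin, hψ, hi.ne']
    · simp [hx i hin, hψ, hi.ne']
  have hrecψ : ∀ (ψ : LaurentRing (ℕ ⊕ ℕ) →+* DualNumber ℤ), ∀ m ≤ n, ψ (x m) * ψ (x (m + n)) =
      binom L R a (fun i => ψ (p i)) (fun i => ψ (x i)) m := fun ψ m hm => by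
    rw [← map_mul, hrec m hm, map_binom]
  have hxn : ∀ (s : ℤˣ) (ψ : LaurentRing (ℕ ⊕ ℕ) →+* DualNumber ℤ),
      ψ (p 0) = -1 + ((s : ℤ) : DualNumber ℤ) * DualNumber.eps →
      ψ (x 0) = ((s : ℤ) : DualNumber ℤ) → (∀ i, 0 < i → i < n → ψ (x i) = 1) →
      ψ (x n) = DualNumber.eps := by
    intro s ψ h0 hx0 hx1
    have h1 := hrecψ ψ 0 n.zero_le
    rw [binom, h0, hx0, Finset.prod_eq_one fun i hi => ?_, Finset.prod_eq_one fun i hi => ?_] at h1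
    · have hu : IsUnit ((s : ℤ) : DualNumber ℤ) := s.isUnit.map (Int.castRingHom _)
      apply hu.mul_left_cancel
      rw [zero_add] at h1
      rw [h1]
      ring
    · rw [zero_add, hx1 i (h.memR i hi).1 (h.memR i hi).2, one_pow]
    · rw [zero_add, hx1 i (h.memL i hi).1 (h.memL i hi).2, one_pow]
  have hpψ : ∀ (s : ℤˣ) (ψ : LaurentRing (ℕ ⊕ ℕ) →+* DualNumber ℤ),
      ψ (p 0) = -1 + ((s : ℤ) : DualNumber ℤ) * DualNumber.eps →
      (∀ i, 0 < i → i < n → ψ (p i) = 1) →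
      ψ (p n) * (-1 + ((s : ℤ) : DualNumber ℤ) * DualNumber.eps) = 1 := by
    intro s ψ h0 hp1
    rw [← h0, ← map_mul, mul_comm, hpn, map_prod]
    refine Finset.prod_eq_one fun i hi => ?_
    rw [map_pow, hp1 i (h.memR i hi).1 (h.memR i hi).2, one_pow]
  have hpos : ∀ (ψ : LaurentRing (ℕ ⊕ ℕ) →+* DualNumber ℤ),
      ψ (x n) = DualNumber.eps → (∀ i, 0 < i → i < n → ψ (p i) = 1) →
      (∀ i, 0 < i → i < n → ψ (x i) = 1) → ∀ j, 0 < j → j < n → 0 < (ψ (x (j + n))).fst := by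
    intro ψ hn hp1 hx1
    refine h.pos_of_confined (p := fun i => (ψ (p i)).fst) (c := fun i => (ψ (x i)).fst)
      (fun i hi hin => by simp [hx1 i hi hin]) (by simp [hn])
      (fun i hi hin => by simp [hp1 i hi hin]) fun m hm hmn => ?_
    have := congrArg (TrivSqZeroExt.fstHom ℤ ℤ ℤ).toRingHom (hrecψ ψ m hmn.le)
    rw [map_mul, map_binom] at this
    exact this
  obtain ⟨ψ, hψp0, hψx0, hψp, hψx⟩ := hex 1
  obtain ⟨φ, hφp0, hφx0, hφp, hφx⟩ := hex (-1)
  have hψn := hxn _ ψ hψp0 hψx0 hψx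
  have hφn := hxn _ φ hφp0 hφx0 hφx
  have hψpos := hpos ψ hψn hψp hψx
  have hφpos := hpos φ hφn hφp hφx
  have hagree : ∀ k, 0 < k → k < n + n → φ (x k) = ψ (x k) := by
    intro k
    induction k using Nat.strong_induction_on with
    | _ k ih =>
      intro hk hkn
      rcases lt_trichotomy k n with hlt | rfl | hgt
      · rw [hψx k hk hlt, hφx k hk hlt]
      · rw [hψn, hφn]
      · obtain ⟨j, rfl⟩ := Nat.exists_eq_add_of_le' hgt.le
        have h1 := hrecψ ψ j (by omega)
        have h2 := hrecψ φ j (by omega)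
        rw [hψx j (by omega) (by omega), one_mul] at h1
        rw [hφx j (by omega) (by omega), one_mul] at h2
        rw [h1, h2]
        refine h.binom_congr ?_ fun i hi hin => ih _ (by omega) (by omega) (by omega)
        rw [hψp j (by omega) (by omega), hφp j (by omega) (by omega)]
  have hψ2 := fst_dual (x := fun i => ψ (x i)) (p := fun i => ψ (p i)) L R a hψn
    (hrecψ ψ n le_rfl) (hpψ _ ψ hψp0 hψp)
  have hφ2 := fst_dual (x := fun i => φ (x i)) (p := fun i => φ (p i)) L R a hφn
    (hrecψ φ n le_rfl) (hpψ _ φ hφp0 hφp)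
  rw [Finset.prod_congr rfl fun i hi => by
      rw [hagree (n + i) (by have := (h.memL i hi).1; omega)
        (by have := (h.memL i hi).2; omega)],
    Finset.prod_congr (s₁ := R) rfl fun i hi => by
      rw [hagree (n + i) (by have := (h.memR i hi).1; omega)
        (by have := (h.memR i hi).2; omega)]] at hφ2
  have hB : 0 < (∏ i ∈ R, ψ (x (n + i)) ^ a i).fst := by
    change 0 < TrivSqZeroExt.fstHom ℤ ℤ ℤ (∏ i ∈ R, ψ (x (n + i)) ^ a i)
    rw [map_prod]
    refine Finset.prod_pos fun i hi => ?_
    rw [map_pow, add_comm]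
    exact pow_pos (hψpos i (h.memR i hi).1 (h.memR i hi).2) _
  push_cast at hψ2 hφ2
  have hfinish : ∀ χ : LaurentRing (ℕ ⊕ ℕ) →+* DualNumber ℤ, χ (x n) = DualNumber.eps →
      (∀ j, 0 < j → j < n → 0 < (χ (x (j + n))).fst) → (χ (x (n + n))).fst ≠ 0 →
      ∃ ψ : LaurentRing (ℕ ⊕ ℕ) →+* ℤ,
        ψ (x n) = 0 ∧ ∀ j, 0 < j → j ≤ n → ψ (x (j + n)) ≠ 0 := by
    intro χ h0 h1 h2
    refine ⟨(TrivSqZeroExt.fstHom ℤ ℤ ℤ).toRingHom.comp χ, ?_, fun j hj hjn => ?_⟩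
    · change (χ (x n)).fst = 0
      rw [h0, DualNumber.fst_eps]
    · change (χ (x (j + n))).fst ≠ 0
      rcases hjn.lt_or_eq with hlt | rfl
      · exact (h1 j hj hlt).ne'
      · exact h2
  by_cases hz : (ψ (x (n + n))).fst = 0
  · refine hfinish φ hφn hφpos fun hz' => ?_
    rw [hz] at hψ2
    rw [hz'] at hφ2
    linarith
  · exact hfinish ψ hψn hψpos hz

lemma prime_clusterVariable (h : FlipSymmetric n L R a) {p x : ℕ → LaurentRing (ℕ ⊕ ℕ)}
    (hp : p 0 = LaurentRing.U (Sum.inr 0 : ℕ ⊕ ℕ))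
    (hx : ∀ i < n, x i = LaurentRing.U (Sum.inl i : ℕ ⊕ ℕ))
    (hrec : x 0 * x n = binom L R a p x 0) (h0 : x n ≠ 0) : Prime (x n) := by
  let A : (LaurentRing (ℕ ⊕ ℕ))ˣ := ∏ i ∈ L, LaurentRing.U (Sum.inl i) ^ a i
  let B : (LaurentRing (ℕ ⊕ ℕ))ˣ := ∏ i ∈ R, LaurentRing.U (Sum.inl i) ^ a i
  let b : (LaurentRing (ℕ ⊕ ℕ))ˣ := -(B * A⁻¹)
  have hrec' : (LaurentRing.U (Sum.inl 0 : ℕ ⊕ ℕ) : LaurentRing (ℕ ⊕ ℕ)) * x n =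
      A * ((LaurentRing.U (Sum.inr 0 : ℕ ⊕ ℕ) : LaurentRing (ℕ ⊕ ℕ)) - b) := by
    have hA : (A : LaurentRing (ℕ ⊕ ℕ)) = ∏ i ∈ L, x (0 + i) ^ a i := by
      simp only [A, Units.coe_prod, Units.val_pow_eq_pow_val, zero_add]
      exact Finset.prod_congr rfl fun i hi => by rw [hx i (h.memL i hi).2]
    have hB : (B : LaurentRing (ℕ ⊕ ℕ)) = ∏ i ∈ R, x (0 + i) ^ a i := by
      simp only [B, Units.coe_prod, Units.val_pow_eq_pow_val, zero_add]
      exact Finset.prod_congr rfl fun i hi => by rw [hx i (h.memR i hi).2]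
    rw [← hx 0 h.pos, hrec, binom, hp, ← hA, ← hB]
    simp only [b, Units.val_neg, Units.val_mul]
    linear_combination -(B : LaurentRing (ℕ ⊕ ℕ)) * A.mul_inv
  have hassoc : Associated
      ((LaurentRing.U (Sum.inr 0 : ℕ ⊕ ℕ) : LaurentRing (ℕ ⊕ ℕ)) - b) (x n) := by
    refine ⟨A * (LaurentRing.U (Sum.inl 0))⁻¹, ?_⟩
    rw [Units.val_mul, mul_comm, mul_right_comm, ← hrec', mul_right_comm, Units.mul_inv, one_mul]
  refine hassoc.prime ?_
  obtain ⟨φ, hφ⟩ := LaurentRing.exists_lift (T := LaurentRing (ℕ ⊕ ℕ))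
    (fun j => if j = Sum.inr 0 then b else LaurentRing.U j)
  have hφu : ∀ i : ℕ, Units.map φ.toMonoidHom (LaurentRing.U (Sum.inl i)) =
      LaurentRing.U (Sum.inl i) := fun i => Units.ext (by simp [hφ])
  have hAB : Units.map φ.toMonoidHom (B * A⁻¹) = B * A⁻¹ := by
    simp only [A, B, map_mul, map_inv, map_prod, map_pow, hφu]
  refine LaurentRing.prime_U_sub (hassoc.ne_zero_iff.mpr h0) φ (fun j hj => ?_) ?_ ?_
  · rw [hφ, if_neg hj]
  · rw [hφ, if_pos rfl]
  · have := congrArg Units.val hAB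
    simp only [b, Units.val_neg, map_neg]
    exact congrArg Neg.neg this

end FlipSymmetric

namespace FlipSymmetric

variable {n : ℕ} {L R : Finset ℕ} {a : ℕ → ℕ}

/-- Laurentness of the term with index `N` for the generic sequence gives it for every nowhere
vanishing sequence. -/
lemma mem_of_generic (h : FlipSymmetric n L R a) {p : ℕ → (LaurentRing (ℕ ⊕ ℕ))ˣ}
    (hp : ∀ i < n, p i = LaurentRing.U (Sum.inr i)) (hpc : IsCoeffSeq n R a p)
    {x : ℕ → LaurentRing (ℕ ⊕ ℕ)} (hx : ∀ i < n, x i = LaurentRing.U (Sum.inl i : ℕ ⊕ ℕ)) {N : ℕ}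
    (hrec : ∀ m, m + n ≤ N → x m * x (m + n) = binom L R a (fun i => (p i).1) x m)
    {K : Type} [Field K] {q y : ℕ → K} (hq : IsCoeffSeq n R a q) (hq0 : ∀ m, q m ≠ 0)
    (hy : ∀ m, y m * y (m + n) = binom L R a q y m) (hy0 : ∀ m, y m ≠ 0)
    (B : Subring K) (hyB : ∀ i < n, y i ∈ B ∧ (y i)⁻¹ ∈ B) (hqB : ∀ i < n, q i ∈ B ∧ (q i)⁻¹ ∈ B) :
    y N ∈ B := by
  obtain ⟨θ, hθ⟩ := LaurentRing.exists_lift (T := K) (Sum.elim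
    (fun i : ℕ => if i < n then Units.mk0 (y i) (hy0 i) else 1)
    (fun i : ℕ => if i < n then Units.mk0 (q i) (hq0 i) else 1))
  have hpq : ∀ m, θ (p m) = q m := by
    refine h.map_coeff_eq θ (p := fun i => (p i).1) (fun m => ?_) hq hq0 fun i hi => ?_
    · simpa using congrArg Units.val (hpc m)
    · simp [hp i hi, hθ, hi]
  have hN := h.map_eq θ hrec hy hy0 hpq (fun i hi => by simp [hx i hi, hθ, hi]) N le_rfl
  rw [← hN]
  refine LaurentRing.range_le θ B (fun j => ?_) (fun j => ?_) (x N)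
  · rw [hθ]
    rcases j with i | i <;> by_cases hi : i < n
    · simpa [hi] using (hyB i hi).1
    · simp [hi]
    · simpa [hi] using (hqB i hi).1
    · simp [hi]
  · rw [hθ]
    rcases j with i | i <;> by_cases hi : i < n
    · simpa [hi] using (hyB i hi).2
    · simp [hi]
    · simpa [hi] using (hqB i hi).2
    · simp [hi]

/-- The generic sequence with coefficients consists of Laurent polynomials. -/
lemma generic_laurent (h : FlipSymmetric n L R a) {p : ℕ → (LaurentRing (ℕ ⊕ ℕ))ˣ}
    (hp : ∀ i < n, p i = LaurentRing.U (Sum.inr i)) (hpc : IsCoeffSeq n R a p)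
    {K : Type} [Field K] [Algebra (LaurentRing (ℕ ⊕ ℕ)) K] [FaithfulSMul (LaurentRing (ℕ ⊕ ℕ)) K]
    {x : ℕ → K} (hx : ∀ i < n, x i = algebraMap (LaurentRing (ℕ ⊕ ℕ)) K
      (LaurentRing.U (Sum.inl i : ℕ ⊕ ℕ)))
    (hx0 : ∀ m, x m ≠ 0) (hrec : ∀ m, x m * x (m + n) =
      binom L R a (fun i => algebraMap (LaurentRing (ℕ ⊕ ℕ)) K (p i)) x m) (N : ℕ) :
    ∃ t, algebraMap (LaurentRing (ℕ ⊕ ℕ)) K t = x N := by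
  have inj := FaithfulSMul.algebraMap_injective (LaurentRing (ℕ ⊕ ℕ)) K
  have hn := h.pos
  induction N using Nat.strong_induction_on with
  | _ N ih =>
    choose! g hg using ih
    rcases lt_or_ge N n with hN | hN
    · exact ⟨_, (hx N hN).symm⟩
    have hgx : ∀ i < n, g i = LaurentRing.U (Sum.inl i : ℕ ⊕ ℕ) := fun i hi =>
      inj (by rw [hg i (by omega), hx i hi])
    have hgrec : ∀ m, m + n < N → g m * g (m + n) = binom L R a (fun i => (p i).1) g m := by
      intro m hm
      apply inj
      rw [map_mul, hg m (by omega), hg _ hm, hrec, map_binom]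
      exact h.binom_congr rfl fun i _ hi => (hg _ (by omega)).symm
    have of_dvd : ∀ m, m + n = N → g m ∣ binom L R a (fun i => (p i).1) g m →
        ∃ t, algebraMap (LaurentRing (ℕ ⊕ ℕ)) K t = x N := by
      rintro m rfl ⟨t, ht⟩
      refine ⟨t, mul_left_cancel₀ (hx0 m) ?_⟩
      rw [hrec, ← hg m (by omega), ← map_mul, ← ht, map_binom]
      exact h.binom_congr rfl fun i _ hi => hg _ (by omega)
    have hcoeff : (p 0).1 * (p n).1 = ∏ i ∈ R, (p i).1 ^ a i := by
      simpa using congrArg Units.val (hpc 0)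
    rcases lt_trichotomy N (n + n) with hlt | rfl | hgt
    · refine of_dvd (N - n) (by omega) (IsUnit.dvd ?_)
      rw [hgx _ (by omega)]
      exact Units.isUnit _
    · refine of_dvd n rfl (h.dvd_binom (fun m hm => hgrec m (by omega)) (fun i hi => ?_) hcoeff
        (p 0).isUnit)
      rw [hgx i hi]
      exact Units.isUnit _
    · have hgn : g n ≠ 0 := fun h0 => hx0 n (by rw [← hg n (by omega), h0, map_zero])
      have hprime : Prime (g n) := h.prime_clusterVariable (p := fun i => (p i).1)
        (by rw [hp 0 hn]) hgx (by simpa using hgrec 0 (by omega)) hgn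
      obtain ⟨ψ, hψn, hψ⟩ := h.exists_point (p := fun i => (p i).1) (fun i hi => by rw [hp i hi])
        hgx hcoeff fun m hm => hgrec m (by omega)
      have hshift : ∀ k, 0 < k → k ≤ N → ∀ B : Subring K,
          (∀ i < n, x (i + k) ∈ B ∧ (x (i + k))⁻¹ ∈ B) →
          (∀ i, algebraMap (LaurentRing (ℕ ⊕ ℕ)) K (p i) ∈ B ∧
            (algebraMap (LaurentRing (ℕ ⊕ ℕ)) K (p i))⁻¹ ∈ B) → x N ∈ B := by
        intro k hk hkN B hB hB'
        have := h.mem_of_generic (N := N - k) hp hpc hgx (fun m hm => hgrec m (by omega))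
          (q := fun i => algebraMap (LaurentRing (ℕ ⊕ ℕ)) K (p (i + k)))
          (y := fun i => x (i + k)) (fun m => ?_) (fun m => ?_) (fun m => ?_) (fun m => hx0 _) B hB
          fun i _ => hB' _
        · simpa [Nat.sub_add_cancel hkN] using this
        · have := congrArg (fun u => algebraMap (LaurentRing (ℕ ⊕ ℕ)) K (Units.val u)) (hpc (m + k))
          simpa [add_right_comm m k] using this
        · exact ((p (m + k)).isUnit.map (algebraMap (LaurentRing (ℕ ⊕ ℕ)) K)).ne_zero
        · simpa [binom, add_right_comm m k] using hrec (m + k)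
      refine mem_range_of_mem_denomSubring hprime
        (M := (nonZeroDivisors ℤ).comap ψ) (fun s hs hdvd => ?_) ?_ ?_
      · obtain ⟨c, rfl⟩ := hdvd
        exact nonZeroDivisors.ne_zero (Submonoid.mem_comap.mp hs) (by rw [map_mul, hψn, zero_mul])
      · refine hshift 1 one_pos (by omega) _ (fun i hi => ?_) fun i =>
          ⟨algebraMap_mem_denomSubring _ _, inv_algebraMap_unit_mem_denomSubring _ (p i).isUnit⟩
        rw [← hg (i + 1) (by omega)]
        refine ⟨algebraMap_mem_denomSubring _ _, ?_⟩
        rcases (Nat.succ_le_of_lt hi).lt_or_eq with hlt | heq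
        · rw [hgx (i + 1) hlt]
          exact inv_algebraMap_unit_mem_denomSubring _ (Units.isUnit _)
        · refine inv_algebraMap_mem_denomSubring ⟨1, ?_⟩ ?_
          · simp [← heq]
          · rw [hg (i + 1) (by omega)]
            exact hx0 _
      · refine hshift (n + 1) (by omega) (by omega) _ (fun i hi => ?_) fun i =>
          ⟨algebraMap_mem_denomSubring _ _, inv_algebraMap_unit_mem_denomSubring _ (p i).isUnit⟩
        rw [← hg (i + (n + 1)) (by omega)]
        refine ⟨algebraMap_mem_denomSubring _ _, inv_algebraMap_mem_denomSubring ?_ ?_⟩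
        · rw [Submonoid.mem_comap, show i + (n + 1) = i + 1 + n by ring]
          exact mem_nonZeroDivisors_of_ne_zero (hψ (i + 1) (by omega) (by omega))
        · rw [hg _ (by omega)]
          exact hx0 _

/-- The Laurent phenomenon for flip-symmetric binomials with trivial coefficients. -/
theorem laurent_phenomenon (h : FlipSymmetric n L R a) {K : Type} [Field K] {y : ℕ → K}
    (hy : ∀ m, y m * y (m + n) = binom L R a (fun _ => 1) y m) (hy0 : ∀ m, y m ≠ 0)
    (B : Subring K) (hB : ∀ i < n, y i ∈ B ∧ (y i)⁻¹ ∈ B) (N : ℕ) : y N ∈ B := by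
  obtain ⟨p, hp, hpc⟩ := h.exists_coeffSeq fun i => LaurentRing.U (Sum.inr i : ℕ ⊕ ℕ)
  obtain ⟨ev, hev⟩ := LaurentRing.exists_lift (σ := ℕ ⊕ ℕ) (T := ℤ) fun _ => 1
  have hpev : ∀ m, ev (p m) = 1 := by
    refine h.map_coeff_eq ev (p := fun i => (p i).1) (q := fun _ => 1) (fun m => ?_) (fun m => ?_)
      (fun _ => one_ne_zero) fun i hi => ?_
    · simpa using congrArg Units.val (hpc m)
    · simp
    · simp [hp i hi, hev]
  obtain ⟨x, hx, hx0, hrec⟩ := h.exists_clusterSeq (K := FractionRing (LaurentRing (ℕ ⊕ ℕ))) ev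
    (p := fun i => (p i).1) (u := fun i => LaurentRing.U (Sum.inl i : ℕ ⊕ ℕ))
    (fun m => by rw [hpev]; exact one_pos) fun m => by simp [hev]
  have inj := FaithfulSMul.algebraMap_injective (LaurentRing (ℕ ⊕ ℕ))
    (FractionRing (LaurentRing (ℕ ⊕ ℕ)))
  choose g hg using h.generic_laurent hp hpc hx hx0 hrec
  refine h.mem_of_generic (N := N) hp hpc (x := g) (fun i hi => inj ?_) (fun m _ => inj ?_)
    (q := fun _ => 1) (fun m => by simp) (fun _ => one_ne_zero) hy hy0 B hB
    fun i _ => by simp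
  · rw [hg, hx i hi]
  · rw [map_mul, hg, hg, hrec, map_binom]
    simp only [hg]

end FlipSymmetric

/-- Flip-symmetric binomial case (family (9) of Theorem 3.7 with Corollary 3.8). -/
theorem stmt10 (n : ℕ) (hn : 2 ≤ n) (L R : Finset ℕ)
    (hL : L ⊆ Finset.Icc 1 (n - 1)) (hR : R ⊆ Finset.Icc 1 (n - 1))
    (hdisj : Disjoint L R)
    (hLsym : ∀ i ∈ Finset.Icc 1 (n - 1), (i ∈ L ↔ n - i ∈ L))
    (hRsym : ∀ i ∈ Finset.Icc 1 (n - 1), (i ∈ R ↔ n - i ∈ R))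
    (a : ℕ → ℕ) (hapos : ∀ i ∈ L ∪ R, 1 ≤ a i)
    (P : MvPolynomial ℕ ℤ)
    (hP : P = (∏ i ∈ L, X i ^ a i) + (∏ i ∈ R, X i ^ a i))
    (hirr : Irreducible P)
    (hndvd : ∀ j ∈ Finset.Icc 1 (n - 1), ¬ X j ∣ P)
    (x : ℕ → FractionRing (MvPolynomial (Fin n) ℤ))
    (hinit : ∀ i : Fin n, x i =
      algebraMap (MvPolynomial (Fin n) ℤ) (FractionRing (MvPolynomial (Fin n) ℤ)) (X i))
    (hnz : ∀ m, x m ≠ 0)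
    (hrec : ∀ m, x m * x (m + n) = aeval (fun i : ℕ => x (m + i)) P) :
    ∀ m, x m ∈ Subring.closure
      ((Set.range fun i : Fin n =>
          algebraMap (MvPolynomial (Fin n) ℤ) (FractionRing (MvPolynomial (Fin n) ℤ)) (X i)) ∪
        (Set.range fun i : Fin n =>
          (algebraMap (MvPolynomial (Fin n) ℤ) (FractionRing (MvPolynomial (Fin n) ℤ)) (X i))⁻¹)) := by
  have hb : ∀ S ⊆ Finset.Icc 1 (n - 1), ∀ i ∈ S, 0 < i ∧ i < n := fun S hS i hi => by
    have := Finset.mem_Icc.mp (hS hi)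
    omega
  have h : FlipSymmetric n L R a :=
    { pos := by omega
      memL := hb L hL
      memR := hb R hR
      disj := hdisj
      symL := fun i hi => (hLsym i (hL hi)).mp hi
      symR := fun i hi => (hRsym i (hR hi)).mp hi
      exp_pos := fun i hi => Nat.one_le_iff_ne_zero.mp (hapos i hi) }
  refine h.laurent_phenomenon (fun m => ?_) hnz _ fun i hi => ?_
  · rw [hrec, hP]
    simp [binom]
  · rw [hinit ⟨i, hi⟩]
    exact ⟨Subring.subset_closure (Or.inl ⟨_, rfl⟩), Subring.subset_closure (Or.inr ⟨_, rfl⟩)⟩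
end

section
/- Fix integers k ≥ 1 and n with n > 2k and n ≠ 3k, and an integer A. Suppose the polynomial P = A·x_k + A·x_{n−k} + x_{2k}·x_{n−2k} is irreducible in ℤ[x_1,…,x_{n−1}] and not divisible by any x_j. Then every term of any sequence x : ℕ → F generated by P is a Laurent polynomial. -/
open MvPolynomial

/-- A nowhere zero sequence satisfying the Little Pi recurrence. -/
structure IsLittlePi (n k : ℕ) (A : ℤ) {K : Type*} [Field K] (y : ℕ → K) : Prop where
  ne_zero : ∀ m, y m ≠ 0
  recurrence : ∀ m, y m * y (m + n) =
    A * y (m + k) + A * y (m + (n - k)) + y (m + 2 * k) * y (m + (n - 2 * k))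

theorem IsLittlePi.shift {n k : ℕ} {A : ℤ} {K : Type*} [Field K] {y : ℕ → K}
    (h : IsLittlePi n k A y) (s : ℕ) : IsLittlePi n k A (fun i => y (s + i)) where
  ne_zero m := h.ne_zero _
  recurrence m := by simpa only [add_assoc] using h.recurrence (s + m)

/-- A quantity attached to sequences over arbitrary fields is universally Laurent if a single
Laurent polynomial in the first `n` terms computes it for every Little Pi sequence. -/
def IsUnivLaurent (n k : ℕ) (A : ℤ) (f : (K : Type) → [Field K] → (ℕ → K) → K) : Prop :=
  ∃ (p : MvPolynomial (Fin n) ℤ) (N : ℕ), ∀ (K : Type) [Field K] (y : ℕ → K),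
    IsLittlePi n k A y → f K y * (∏ i : Fin n, y i) ^ N = aeval (fun i : Fin n => y i) p

namespace IsUnivLaurent

variable {n k : ℕ} {A : ℤ} {f g : (K : Type) → [Field K] → (ℕ → K) → K}

theorem congr (hf : IsUnivLaurent n k A f)
    (h : ∀ (K : Type) [Field K] (y : ℕ → K), IsLittlePi n k A y → g K y = f K y) :
    IsUnivLaurent n k A g := by
  obtain ⟨p, N, hp⟩ := hf
  exact ⟨p, N, fun K _ y hy => by rw [h K y hy, hp K y hy]⟩

theorem add (hf : IsUnivLaurent n k A f) (hg : IsUnivLaurent n k A g) :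
    IsUnivLaurent n k A (fun K _ y => f K y + g K y) := by
  obtain ⟨p, N, hp⟩ := hf
  obtain ⟨q, M, hq⟩ := hg
  refine ⟨p * (∏ i, X i) ^ M + q * (∏ i, X i) ^ N, N + M, fun K _ y hy => ?_⟩
  simp only [map_add, map_mul, map_pow, map_prod, aeval_X, ← hp K y hy, ← hq K y hy]
  ring

theorem mul (hf : IsUnivLaurent n k A f) (hg : IsUnivLaurent n k A g) :
    IsUnivLaurent n k A (fun K _ y => f K y * g K y) := by
  obtain ⟨p, N, hp⟩ := hf
  obtain ⟨q, M, hq⟩ := hg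
  refine ⟨p * q, N + M, fun K _ y hy => ?_⟩
  simp only [map_mul, ← hp K y hy, ← hq K y hy]
  ring

theorem intCast (a : ℤ) : IsUnivLaurent n k A (fun K _ _ => (a : K)) :=
  ⟨C a, 0, fun K _ y _ => by simp⟩

theorem pow (hf : IsUnivLaurent n k A f) (N : ℕ) :
    IsUnivLaurent n k A (fun K _ y => f K y ^ N) := by
  induction N with
  | zero => exact (intCast 1).congr fun K _ y _ => by simp
  | succ N ih => exact (ih.mul hf).congr fun K _ y _ => pow_succ _ _

theorem initial {i : ℕ} (hi : i < n) : IsUnivLaurent n k A (fun _ _ y => y i) :=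
  ⟨X ⟨i, hi⟩, 0, fun K _ y _ => by simp⟩

theorem inv_initial {i : ℕ} (hi : i < n) : IsUnivLaurent n k A (fun _ _ y => (y i)⁻¹) := by
  refine ⟨∏ j ∈ Finset.univ.erase (⟨i, hi⟩ : Fin n), X j, 1, fun K _ y hy => ?_⟩
  rw [← Finset.mul_prod_erase Finset.univ (fun j : Fin n => y j) (Finset.mem_univ ⟨i, hi⟩)]
  simp [inv_mul_cancel_left₀ (hy.ne_zero i)]

theorem prod {ι : Type*} (s : Finset ι) {F : ι → (K : Type) → [Field K] → (ℕ → K) → K}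
    (h : ∀ i ∈ s, IsUnivLaurent n k A (F i)) :
    IsUnivLaurent n k A (fun K _ y => ∏ i ∈ s, F i K y) := by
  classical
  induction s using Finset.induction_on with
  | empty => exact (intCast 1).congr fun K _ y _ => by simp
  | insert a s ha ih =>
    refine ((h a (by simp)).mul (ih fun i hi => h i (by simp [hi]))).congr fun K _ y _ => ?_
    rw [Finset.prod_insert ha]

theorem polynomial_eval {ι : Type*} (p : MvPolynomial ι ℤ)
    {F : ι → (K : Type) → [Field K] → (ℕ → K) → K}
    (h : ∀ i, IsUnivLaurent n k A (F i)) :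
    IsUnivLaurent n k A (fun K _ y => aeval (fun i => F i K y) p) := by
  induction p using MvPolynomial.induction_on with
  | C a => exact (intCast a).congr fun K _ y _ => by simp
  | add p q hp hq => exact (hp.add hq).congr fun K _ y _ => by simp
  | mul_X p i hp => exact (hp.mul (h i)).congr fun K _ y _ => by simp

/-- If the `m`-th term is universally Laurent, then the `(s + m)`-th term becomes universally
Laurent after multiplication with a power of `y s * ⋯ * y (s + n - 1)`. -/
theorem exists_shift {m : ℕ} (hm : IsUnivLaurent n k A (fun _ _ y => y m)) (s : ℕ)
    (hs : ∀ i < n, IsUnivLaurent n k A (fun _ _ y => y (s + i))) :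
    ∃ N, IsUnivLaurent n k A (fun _ _ y => y (s + m) * (∏ i : Fin n, y (s + i)) ^ N) := by
  obtain ⟨p, N, hp⟩ := hm
  exact ⟨N, (polynomial_eval p fun i : Fin n => hs i i.2).congr fun K _ y hy => hp K _ (hy.shift s)⟩

theorem term_of_lt_two_mul (hk : 1 ≤ k) (hn : 2 * k < n) (m : ℕ) (hm : m < 2 * n) :
    IsUnivLaurent n k A (fun _ _ y => y m) := by
  induction m using Nat.strong_induction_on with
  | _ m ih =>
    rcases lt_or_ge m n with h | h
    · exact initial h
    obtain ⟨j, rfl⟩ := Nat.exists_eq_add_of_le' h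
    have t (i : ℕ) (hi : i < n) := ih (j + i) (by omega) (by omega)
    refine (((((intCast A).mul (t k (by omega))).add
      ((intCast A).mul (t (n - k) (by omega)))).add ((t (2 * k) (by omega)).mul
      (t (n - 2 * k) (by omega)))).mul (inv_initial (i := j) (by omega))).congr fun K _ y hy => ?_
    rw [eq_mul_inv_iff_mul_eq₀ (hy.ne_zero j), ← hy.recurrence j, mul_comm]

theorem term_two_mul (hk : 1 ≤ k) (hn : 2 * k < n) :
    IsUnivLaurent n k A (fun _ _ y => y (n + n)) := by
  have t (i : ℕ) (hi : i < 2 * n) := term_of_lt_two_mul (A := A) hk hn i hi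
  have a := intCast (n := n) (k := k) (A := A) A
  have b := t (2 * k) (by omega)
  have c := t (3 * k) (by omega)
  have d := t (n - k) (by omega)
  have e := t (n - 2 * k) (by omega)
  have f := t (4 * k) (by omega)
  have h := t (n - 2 * k + (n - 2 * k)) (by omega)
  have s := t (n - 2 * k + n) (by omega)
  have u := t (k + n) (by omega)
  have v := t (n - 2 * k + (n - k)) (by omega)
  have a2 := intCast (n := n) (k := k) (A := A) (-A ^ 2)
  refine ((((((a.mul (a.mul (b.mul e))).add (d.mul (f.mul (e.mul s)))).add
    (a.mul (d.mul ((c.add u).mul h)))).add (a.mul (a.mul (b.mul h)))).add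
    (a.mul ((d.add v).mul (((t 0 (by omega)).mul u).add a2)))).mul
    ((inv_initial (i := n - k) (by omega)).mul ((inv_initial (i := 2 * k) (by omega)).mul
      (inv_initial (i := n - 2 * k) (by omega))))).congr fun K _ y hy => ?_
  have W0 := hy.recurrence 0
  have W1 := hy.recurrence k
  have W2 := hy.recurrence (2 * k)
  have W3 := hy.recurrence (n - 2 * k)
  have W4 := hy.recurrence (n - k)
  have W := hy.recurrence n
  rw [show k + k = 2 * k by omega, show k + (n - k) = n by omega,
    show k + 2 * k = 3 * k by omega, show k + (n - 2 * k) = n - k by omega] at W1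
  rw [show 2 * k + k = 3 * k by omega, show 2 * k + (n - k) = k + n by omega,
    show 2 * k + 2 * k = 4 * k by omega, show 2 * k + (n - 2 * k) = n by omega] at W2
  rw [show n - 2 * k + k = n - k by omega, show n - 2 * k + 2 * k = n by omega] at W3
  rw [show n - k + k = n by omega, show n - k + (n - k) = n - 2 * k + n by omega,
    show n - k + 2 * k = k + n by omega,
    show n - k + (n - 2 * k) = n - 2 * k + (n - k) by omega] at W4
  rw [show n + k = k + n by omega, show n + (n - k) = n - k + n by omega,
    show n + 2 * k = 2 * k + n by omega, show n + (n - 2 * k) = n - 2 * k + n by omega] at W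
  simp only [zero_add] at W0
  have hd := hy.ne_zero (n - k)
  have hb := hy.ne_zero (2 * k)
  have he := hy.ne_zero (n - 2 * k)
  have hz := hy.ne_zero n
  rw [← mul_inv, ← mul_inv, eq_mul_inv_iff_mul_eq₀ (mul_ne_zero hd (mul_ne_zero hb he))]
  refine mul_left_cancel₀ hz ?_
  push_cast
  generalize y (n - k) = d at *
  generalize y (2 * k) = b at *
  generalize y (n - 2 * k) = e at *
  generalize y n = z at *
  generalize y (3 * k) = c at *
  generalize y (4 * k) = f at *
  generalize y (n - 2 * k + (n - 2 * k)) = h at *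
  generalize y (n - 2 * k + n) = s at *
  generalize y (k + n) = u at *
  generalize y (n - 2 * k + (n - k)) = v at *
  generalize (A : K) = a at *
  linear_combination d * b * e * W + a * b * e * W4 + d * e * s * W2 +
    (d * a * (c + u) + a ^ 2 * b) * W3 - a * (d + v) * u * W0 - a ^ 2 * (d + v) * W1

end IsUnivLaurent

section Hyperbolic

open Real

theorem cosh_recurrence {σ w B : ℝ} (hσ : σ ^ 2 = cosh B) (θ : ℝ) :
    (cosh (θ - w - B) - cosh w * σ) * (cosh (θ + w + B) - cosh w * σ) =
      -2 * σ * sinh w * sinh B * (cosh (θ - w) - cosh w * σ) +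
      -2 * σ * sinh w * sinh B * (cosh (θ + w) - cosh w * σ) +
      (cosh (θ - w + B) - cosh w * σ) * (cosh (θ + w - B) - cosh w * σ) := by
  simp only [cosh_add, cosh_sub, sinh_add, sinh_sub]
  have h1 := cosh_sq θ
  have h3 := cosh_sq B
  linear_combination 4 * sinh w * cosh w * sinh B * (cosh B * h1 - hσ)

theorem four_mul_cosh_le (a l : ℝ) (hl : 4 ≤ cosh l) (hl0 : 0 ≤ l) (ha : l ≤ a) :
    4 * cosh (a - l) ≤ cosh a := by
  have h1 := cosh_add (a - l) l
  rw [sub_add_cancel] at h1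
  have := mul_le_mul_of_nonneg_left hl (cosh_pos (a - l)).le
  have := mul_nonneg (sinh_nonneg_iff.2 (sub_nonneg.2 ha)) (sinh_nonneg_iff.2 hl0)
  linarith

/-- A positive number `r` with `cosh r = cosh w * √(cosh B)` lies strictly between
`w + B / 2 - l / 2` and `w + B / 2`, as soon as `l` is large and `B` and `w` are not smaller
than `l` and `l / 2`. -/
theorem exists_cosh_eq {l w B : ℝ} (hl : 4 ≤ cosh l) (hl0 : 0 ≤ l) (hB : l ≤ B)
    (hw : l ≤ 2 * w) :
    ∃ r, cosh r = cosh w * √(cosh B) ∧ 2 * w + B - l < 2 * r ∧ 2 * r < 2 * w + B := by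
  have hs : (√(cosh B)) ^ 2 = cosh B := sq_sqrt (cosh_pos B).le
  have h1 : 1 ≤ cosh w * √(cosh B) :=
    one_le_mul_of_one_le_of_one_le (one_le_cosh w) (one_le_sqrt.2 (one_le_cosh B))
  obtain ⟨r, hr0, hr⟩ : ∃ r, 0 ≤ r ∧ cosh r = cosh w * √(cosh B) :=
    ⟨arcosh _, arcosh_nonneg h1, cosh_arcosh h1⟩
  have h2 (x : ℝ) : cosh (2 * x) = 2 * cosh x ^ 2 - 1 := by
    rw [cosh_two_mul, cosh_sq]; ring
  have key : cosh (2 * r) = (cosh (2 * w + B) + cosh (2 * w - B)) / 2 + cosh B - 1 := by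
    rw [h2, hr, mul_pow, hs, cosh_add, cosh_sub, h2 w]; ring
  have h4 := four_mul_cosh_le (2 * w + B) l hl hl0 (by linarith)
  have h5 : cosh (2 * w - B) ≤ cosh (2 * w + B - l) := by
    rw [cosh_le_cosh, abs_of_nonneg (a := 2 * w + B - l) (by linarith), abs_le]
    constructor <;> linarith
  have h6 : cosh B ≤ cosh (2 * w + B - l) := by
    rw [cosh_le_cosh, abs_of_nonneg (by linarith), abs_of_nonneg (by linarith)]; linarith
  have h7 := one_le_cosh (2 * w + B - l)
  have h8 := cosh_pos (2 * w - B)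
  have h9 := one_le_cosh B
  have lower : cosh (2 * w + B - l) < cosh (2 * r) := by linarith
  have upper : cosh (2 * r) < cosh (2 * w + B) := by linarith
  rw [cosh_lt_cosh, abs_of_nonneg (by linarith), abs_of_nonneg (by linarith)] at lower upper
  exact ⟨r, hr, lower, upper⟩

end Hyperbolic

/-- There is a real solution of the Little Pi recurrence whose only zero is the `n`-th term,
together with a deformation of it into nowhere zero solutions. -/
theorem exists_real_family {n k : ℕ} {A : ℤ} (hk : 1 ≤ k) (hn : 2 * k < n) (hA : A ≠ 0) :
    ∃ (ξ : ℝ → ℕ → ℝ) (ε : ℝ), 0 < ε ∧ (∀ i, Continuous fun t => ξ t i) ∧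
      (∀ t m, ξ t m * ξ t (m + n) = A * ξ t (m + k) + A * ξ t (m + (n - k)) +
        ξ t (m + 2 * k) * ξ t (m + (n - 2 * k))) ∧
      (∀ t ∈ Set.Ioo 0 ε, ∀ m, ξ t m ≠ 0) ∧ ξ 0 n = 0 ∧ ∀ i ≠ n, ξ 0 i ≠ 0 := by
  have hl : 4 ≤ Real.cosh 8 := by
    have := Real.add_one_le_exp 8
    have := Real.exp_pos (-8)
    rw [Real.cosh_eq]
    linarith
  have hk' : (1 : ℝ) ≤ k := by exact_mod_cast hk
  have hn' : (2 : ℝ) * k + 1 ≤ n := by exact_mod_cast hn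
  set w : ℝ := 4 * (n - 2 * k) with hw
  set B : ℝ := 8 * k with hB
  obtain ⟨r, hr, hlow, hupp⟩ := exists_cosh_eq (w := w) (B := B) hl (by norm_num)
    (by linarith) (by linarith)
  have hσ : (√(Real.cosh B)) ^ 2 = Real.cosh B := Real.sq_sqrt (Real.cosh_pos B).le
  have hσ0 : √(Real.cosh B) ≠ 0 := (Real.sqrt_pos.2 (Real.cosh_pos B)).ne'
  have hsw : Real.sinh w ≠ 0 := (Real.sinh_pos_iff.2 (by linarith)).ne'
  have hsB : Real.sinh B ≠ 0 := (Real.sinh_pos_iff.2 (by linarith)).ne'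
  have hA' : (A : ℝ) ≠ 0 := by exact_mod_cast hA
  set D : ℝ := -2 * √(Real.cosh B) * Real.sinh w * Real.sinh B with hD
  have hD0 : D ≠ 0 := by simp [hD, hσ0, hsw, hsB]
  have hzero (t : ℝ) (ht : t ∈ Set.Ico 0 (min 8 (2 * w + B - 2 * r))) (i : ℕ)
      (h : Real.cosh (8 * ((i : ℝ) - n) + r + t) = Real.cosh r) : t = 0 ∧ i = n := by
    obtain ⟨ht0, ht1⟩ := ht
    obtain ⟨ht1, ht2⟩ := lt_min_iff.1 ht1
    have habs := le_antisymm (Real.cosh_le_cosh.1 h.le) (Real.cosh_le_cosh.1 h.ge)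
    rcases abs_eq_abs.1 habs with h1 | h1
    · have h3 : (n : ℝ) < i + 1 := by linarith
      have h4 : (i : ℝ) ≤ n := by linarith
      have h5 : i = n := by
        have h3' : n < i + 1 := by exact_mod_cast h3
        have h4' : i ≤ n := by exact_mod_cast h4
        omega
      exact ⟨by rw [h5] at h1; linarith, h5⟩
    · have h3 : (k : ℝ) < i := by linarith
      have h4 : (i : ℝ) < k + 1 := by linarith
      have h3' : k < i := by exact_mod_cast h3
      have h4' : i < k + 1 := by exact_mod_cast h4
      omega
  refine ⟨fun t i => A / D * (Real.cosh (8 * ((i : ℝ) - n) + r + t) - Real.cosh r),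
    min 8 (2 * w + B - 2 * r), lt_min (by norm_num) (by linarith), fun i => by fun_prop,
    fun t m => ?_, fun t ht m => ?_, by simp, fun i hi => ?_⟩
  · have := cosh_recurrence (w := w) hσ (8 * ((m : ℝ) - n) + r + t + 4 * n)
    push_cast [Nat.cast_sub hn.le, Nat.cast_sub (show k ≤ n by omega)]
    rw [← hr, ← hD] at this
    rw [show 8 * ((m : ℝ) - n) + r + t + 4 * n - w - B = 8 * ((m : ℝ) - n) + r + t by
        simp only [hw, hB]; ring,
      show 8 * ((m : ℝ) - n) + r + t + 4 * n + w + B = 8 * ((m : ℝ) + n - n) + r + t by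
        simp only [hw, hB]; ring,
      show 8 * ((m : ℝ) - n) + r + t + 4 * n - w = 8 * ((m : ℝ) + k - n) + r + t by
        simp only [hw]; ring,
      show 8 * ((m : ℝ) - n) + r + t + 4 * n + w = 8 * ((m : ℝ) + (n - k) - n) + r + t by
        simp only [hw]; ring,
      show 8 * ((m : ℝ) + k - n) + r + t + B = 8 * ((m : ℝ) + 2 * k - n) + r + t by
        simp only [hB]; ring,
      show 8 * ((m : ℝ) + (n - k) - n) + r + t - B =
          8 * ((m : ℝ) + (n - 2 * k) - n) + r + t by
        simp only [hB]; ring] at this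
    have hDD : (A : ℝ) / D * D = A := div_mul_cancel₀ _ hD0
    generalize (A : ℝ) / D = q at *
    rw [← hDD]
    linear_combination q ^ 2 * this
  · refine mul_ne_zero (div_ne_zero hA' hD0) (sub_ne_zero.2 fun h => ?_)
    exact ht.1.ne' (hzero t ⟨ht.1.le, ht.2⟩ m h).1
  · refine mul_ne_zero (div_ne_zero hA' hD0) (sub_ne_zero.2 fun h => hi ?_)
    exact (hzero 0 ⟨le_rfl, lt_min (by norm_num) (by linarith)⟩ i h).2

/-- The Little Pi polynomial in the variables indexed by `Fin n`. -/
noncomputable def littlePi {n k : ℕ} (A : ℤ) (hk : 1 ≤ k) (hn : 2 * k < n) :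
    MvPolynomial (Fin n) ℤ :=
  C A * X ⟨k, by omega⟩ + C A * X ⟨n - k, by omega⟩ +
    X ⟨2 * k, hn⟩ * X ⟨n - 2 * k, by omega⟩

theorem rename_littlePi {n k : ℕ} (A : ℤ) (hk : 1 ≤ k) (hn : 2 * k < n) :
    rename Fin.val (littlePi A hk hn) =
      C A * X k + C A * X (n - k) + X (2 * k) * X (n - 2 * k) := by
  simp [littlePi]

theorem aeval_littlePi {n k : ℕ} {A : ℤ} (hk : 1 ≤ k) (hn : 2 * k < n) {K : Type*} [Field K]
    {y : ℕ → K} (hy : y 0 * y (0 + n) =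
      A * y (0 + k) + A * y (0 + (n - k)) + y (0 + 2 * k) * y (0 + (n - 2 * k))) :
    aeval (fun i : Fin n => y i) (littlePi A hk hn) = y 0 * y n := by
  simp only [zero_add] at hy
  simp [littlePi, hy]

theorem irreducible_of_irreducible_rename {σ τ R : Type*} [CommRing R] {f : σ → τ}
    (hf : Function.Injective f) {p : MvPolynomial σ R} (hp : Irreducible (rename f p)) :
    Irreducible p where
  not_isUnit h := hp.not_isUnit (h.map (rename f))
  isUnit_or_isUnit a b hab := by
    have h (q : MvPolynomial σ R) (hq : IsUnit (rename f q)) : IsUnit q := by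
      simpa only [killCompl_rename_app] using hq.map (killCompl hf)
    exact (hp.isUnit_or_isUnit (by rw [hab, map_mul])).imp (h a) (h b)

theorem ne_zero_of_irreducible {i j k l : ℕ} {A : ℤ}
    (h : Irreducible (C A * X i + C A * X j + X k * X l : MvPolynomial ℕ ℤ)) : A ≠ 0 := by
  rintro rfl
  have hX (i : ℕ) : ¬ IsUnit (X i : MvPolynomial ℕ ℤ) := fun hu => by
    simpa using hu.map (eval (0 : ℕ → ℤ))
  rcases h.isUnit_or_isUnit (a := X k) (b := X l) (by simp) with hu | hu
  exacts [hX _ hu, hX _ hu]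

namespace IsUnivLaurent

variable {n k : ℕ} {A : ℤ} {f q : (K : Type) → [Field K] → (ℕ → K) → K}
  {L : Type} [Field L] [Algebra (MvPolynomial (Fin n) ℤ) L] {x : ℕ → L}

/-- The numerator of the Laurent polynomial `y (n + 1) * ⋯ * y (2 * n)` does not vanish at a real
point whose sequence has the `n`-th term as its only zero and deforms into nowhere zero solutions. -/
theorem aeval_real_ne_zero {r : MvPolynomial (Fin n) ℤ} {N : ℕ} {ξ : ℝ → ℕ → ℝ} {ε : ℝ}
    (hε : 0 < ε) (hcont : ∀ i, Continuous fun t => ξ t i)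
    (hsol : ∀ t ∈ Set.Ioo 0 ε, IsLittlePi n k A (ξ t)) (hne : ∀ i ≠ n, ξ 0 i ≠ 0)
    (hr : ∀ (K : Type) [Field K] (y : ℕ → K), IsLittlePi n k A y →
      (∏ i : Fin n, y (n + 1 + i)) * (∏ i : Fin n, y i) ^ N = aeval (fun i : Fin n => y i) r) :
    aeval (fun i : Fin n => ξ 0 i) r ≠ 0 := by
  have hclosed : IsClosed {t | (∏ i : Fin n, ξ t (n + 1 + i)) * (∏ i : Fin n, ξ t i) ^ N =
      aeval (fun i : Fin n => ξ t i) r} := by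
    refine isClosed_eq (by fun_prop) ?_
    simp only [aeval_def, ← eval_map]
    exact (MvPolynomial.continuous_eval _).comp (continuous_pi fun i => hcont i)
  have h0 := hclosed.closure_subset_iff.2 (fun t ht => hr ℝ (ξ t) (hsol t ht))
    (show (0 : ℝ) ∈ closure (Set.Ioo 0 ε) by
      rw [closure_Ioo hε.ne]; exact ⟨le_rfl, hε.le⟩)
  rw [← show _ = _ from h0]
  refine mul_ne_zero ?_ (pow_ne_zero _ ?_) <;> refine Finset.prod_ne_zero_iff.2 fun i _ => ?_
  · exact hne _ (by omega)
  · exact hne _ i.2.ne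

/-- A quantity which is Laurent up to powers of `y n` and also up to powers of a quantity prime to
`y n` is Laurent. -/
theorem of_mul_pow [FaithfulSMul (MvPolynomial (Fin n) ℤ) L]
    (hk : 1 ≤ k) (hn : 2 * k < n) (hx : IsLittlePi n k A x)
    (hinit : ∀ i : Fin n, x i = algebraMap (MvPolynomial (Fin n) ℤ) L (X i))
    (hprime : Prime (littlePi A hk hn)) {a b : ℕ}
    (hfn : IsUnivLaurent n k A (fun K _ y => f K y * y n ^ a))
    (hfq : IsUnivLaurent n k A (fun K _ y => f K y * q K y ^ b))
    {r : MvPolynomial (Fin n) ℤ} {N : ℕ}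
    (hr : ∀ (K : Type) [Field K] (y : ℕ → K), IsLittlePi n k A y →
      q K y * (∏ i : Fin n, y i) ^ N = aeval (fun i : Fin n => y i) r)
    (hndvd : ¬ littlePi A hk hn ∣ r) (hndvd' : ∀ i, ¬ littlePi A hk hn ∣ X i) :
    IsUnivLaurent n k A f := by
  obtain ⟨p₁, M₁, h₁⟩ := hfn.mul ((initial (i := 0) (by omega)).pow a)
  obtain ⟨p₂, M₂, h₂⟩ := hfq
  have hgen (p : MvPolynomial (Fin n) ℤ) :
      aeval (fun i : Fin n => x i) p = algebraMap _ L p := by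
    simp_rw [hinit]
    induction p using MvPolynomial.induction_on with
    | C a => simp
    | add p q hp hq => simp [hp, hq]
    | mul_X p i hp => simp [hp]
  have hpoly : (r ^ b * (∏ i, X i) ^ M₂) * p₁ =
      littlePi A hk hn ^ a * (p₂ * (∏ i, X i) ^ (N * b + M₁)) := by
    apply FaithfulSMul.algebraMap_injective (MvPolynomial (Fin n) ℤ) L
    simp only [← hgen, map_mul, map_pow, map_prod, aeval_X, ← h₁ L x hx, ← h₂ L x hx,
      ← hr L x hx, aeval_littlePi hk hn (hx.recurrence 0)]
    ring
  have hnd : ¬ littlePi A hk hn ∣ r ^ b * (∏ i, X i) ^ M₂ := fun h => by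
    rcases hprime.dvd_or_dvd h with h | h
    · exact hndvd (hprime.dvd_of_dvd_pow h)
    · obtain ⟨i, -, hi⟩ := hprime.exists_mem_finset_dvd (hprime.dvd_of_dvd_pow h)
      exact hndvd' i hi
  obtain ⟨p, rfl⟩ := hprime.pow_dvd_of_dvd_mul_left a hnd ⟨_, hpoly⟩
  refine ⟨p, M₁, fun K _ y hy => ?_⟩
  have h := h₁ K y hy
  rw [map_mul, map_pow, aeval_littlePi hk hn (hy.recurrence 0)] at h
  refine mul_left_cancel₀ (pow_ne_zero a (mul_ne_zero (hy.ne_zero 0) (hy.ne_zero n))) ?_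
  rw [← h]
  ring

theorem term [FaithfulSMul (MvPolynomial (Fin n) ℤ) L]
    (hk : 1 ≤ k) (hn : 2 * k < n) (hA : A ≠ 0)
    (hirr : Irreducible (littlePi A hk hn)) (hx : IsLittlePi n k A x)
    (hinit : ∀ i : Fin n, x i = algebraMap (MvPolynomial (Fin n) ℤ) L (X i)) (m : ℕ) :
    IsUnivLaurent n k A (fun _ _ y => y m) := by
  have hbase (j : ℕ) (hj : j ≤ 2 * n) : IsUnivLaurent n k A (fun _ _ y => y j) := by
    rcases hj.lt_or_eq with h | rfl
    · exact term_of_lt_two_mul hk hn j h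
    · rw [two_mul]; exact term_two_mul hk hn
  obtain ⟨ξ, ε, hε, hcont, hrec, hne, hξn, hξ⟩ := exists_real_family hk hn hA
  obtain ⟨r, N, hr⟩ : IsUnivLaurent n k A (fun _ _ y => ∏ i : Fin n, y (n + 1 + i)) :=
    prod _ fun i _ => hbase _ (by omega)
  have hdvd (p : MvPolynomial (Fin n) ℤ) (h : littlePi A hk hn ∣ p) :
      aeval (fun i : Fin n => ξ 0 i) p = 0 := by
    obtain ⟨q, rfl⟩ := h
    rw [map_mul, aeval_littlePi hk hn (hrec 0 0), hξn, mul_zero, zero_mul]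
  have hndvd : ¬ littlePi A hk hn ∣ r := fun h =>
    aeval_real_ne_zero hε hcont (fun t ht => ⟨hne t ht, hrec t⟩) hξ hr (hdvd r h)
  have hndvd' (i : Fin n) : ¬ littlePi A hk hn ∣ X i := fun h =>
    hξ i i.2.ne (by simpa using hdvd _ h)
  induction m using Nat.strong_induction_on with
  | _ m ih =>
    rcases le_or_gt m (2 * n) with hm | hm
    · exact hbase m hm
    obtain ⟨a, ha⟩ := (ih (m - 1) (by omega)).exists_shift 1 fun i hi => hbase _ (by omega)
    obtain ⟨b, hb⟩ := (ih (m - (n + 1)) (by omega)).exists_shift (n + 1)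
      fun i hi => hbase _ (by omega)
    rw [show 1 + (m - 1) = m by omega] at ha
    rw [show n + 1 + (m - (n + 1)) = m by omega] at hb
    refine of_mul_pow hk hn hx hinit hirr.prime (a := a) ?_ hb hr hndvd hndvd'
    refine (ha.mul ((prod (Finset.range (n - 1)) fun i hi =>
      inv_initial (i := 1 + i) (by grind)).pow a)).congr fun K _ y hy => ?_
    rw [Fin.prod_univ_eq_prod_range (fun i => y (1 + i)) n,
      show n = n - 1 + 1 by omega, Finset.prod_range_succ, show 1 + (n - 1) = n by omega,
      show n - 1 + 1 - 1 = n - 1 by omega, mul_assoc, ← mul_pow, Finset.prod_inv_distrib,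
      show n - 1 + 1 = n by omega]
    congr 2
    have := Finset.prod_ne_zero_iff.2 fun i (_ : i ∈ Finset.range (n - 1)) => hy.ne_zero (1 + i)
    field_simp

theorem mem_closure (hf : IsUnivLaurent n k A f) (hx : IsLittlePi n k A x)
    (hinit : ∀ i : Fin n, x i = algebraMap (MvPolynomial (Fin n) ℤ) L (X i)) :
    f L x ∈ Subring.closure
      ((Set.range fun i : Fin n => algebraMap (MvPolynomial (Fin n) ℤ) L (X i)) ∪
        (Set.range fun i : Fin n => (algebraMap (MvPolynomial (Fin n) ℤ) L (X i))⁻¹)) := by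
  obtain ⟨p, N, hp⟩ := hf
  have hne : (∏ i : Fin n, x i) ^ N ≠ 0 :=
    pow_ne_zero _ (Finset.prod_ne_zero_iff.2 fun i _ => hx.ne_zero i)
  rw [(eq_mul_inv_iff_mul_eq₀ hne).2 (hp L x hx), ← inv_pow, ← Finset.prod_inv_distrib]
  simp_rw [hinit]
  clear hp
  refine mul_mem ?_ (pow_mem (prod_mem fun i _ => ?_) _)
  swap
  · exact Subring.subset_closure (Or.inr (Set.mem_range_self i))
  induction p using MvPolynomial.induction_on with
  | C a => simp
  | add p q hp hq => simpa using add_mem hp hq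
  | mul_X p i hp =>
    rw [map_mul, aeval_X]
    exact mul_mem hp (Subring.subset_closure (Or.inl (Set.mem_range_self i)))

end IsUnivLaurent

/-- Little Pi polynomial case (family (12) of Theorem 3.7 with Corollary 3.8). -/
theorem stmt11 (n k : ℕ) (hk : 1 ≤ k) (hn : 2 * k < n) (hnk : n ≠ 3 * k)
    (A : ℤ) (P : MvPolynomial ℕ ℤ)
    (hP : P = C A * X k + C A * X (n - k) + X (2 * k) * X (n - 2 * k))
    (hirr : Irreducible P)
    (hndvd : ∀ j ∈ Finset.Icc 1 (n - 1), ¬ X j ∣ P)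
    (x : ℕ → FractionRing (MvPolynomial (Fin n) ℤ))
    (hinit : ∀ i : Fin n, x i =
      algebraMap (MvPolynomial (Fin n) ℤ) (FractionRing (MvPolynomial (Fin n) ℤ)) (X i))
    (hnz : ∀ m, x m ≠ 0)
    (hrec : ∀ m, x m * x (m + n) = aeval (fun i : ℕ => x (m + i)) P) :
    ∀ m, x m ∈ Subring.closure
      ((Set.range fun i : Fin n =>
          algebraMap (MvPolynomial (Fin n) ℤ) (FractionRing (MvPolynomial (Fin n) ℤ)) (X i)) ∪
        (Set.range fun i : Fin n =>
          (algebraMap (MvPolynomial (Fin n) ℤ) (FractionRing (MvPolynomial (Fin n) ℤ)) (X i))⁻¹)) := by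
  subst hP
  have hx : IsLittlePi n k A x := ⟨hnz, fun m => by simpa using hrec m⟩
  have hirr' : Irreducible (littlePi A hk hn) :=
    irreducible_of_irreducible_rename Fin.val_injective (by rwa [rename_littlePi])
  exact fun m => (IsUnivLaurent.term hk hn (ne_zero_of_irreducible hirr) hirr' hx hinit
    m).mem_closure hx hinit
end
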